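/- arXiv:2005.08779 — 4 statements merged into one kernel-verified Lean document; each statement's English description precedes it below -/
import Mathlib

section
/- Let S be a simple injective left A-module, e a primitive idempotent of A with eS ≠ 0, B = A/AeA, and M = Ω S = rad P(S). Then a finitely generated B-module U is semi-Gorenstein-projective as an A-module if and only if U is semi-Gorenstein-projective as a B-module and Ext^i_B(U, M) = 0 for all i ≥ 1. -/
/-!
Common background: `A` is an artin algebra (an algebra over a commutative artinian
ring `k`, finitely generated as `k`-module).  Left `A`-modules are `Module A M`;
right `A`-modules are `Module Aᵐᵒᵖ N`.  `Dl A M = Hom_A(M,A)` is the `A`-dual of a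
left module (a right module) and `Dr A N` the dual of a right module (a left module);
`evalL A M : M → M**` is the canonical evaluation map `φ_M`.
-/

open CategoryTheory LinearMap

universe u

section Preliminaries

variable (A : Type u) [Ring A]

/-- The `A`-dual of a left `A`-module: `M* = Hom_A(M, A)`, a right `A`-module. -/
abbrev Dl (M : Type u) [AddCommGroup M] [Module A M] : Type u := M →ₗ[A] A

/-- The `A`-dual of a right `A`-module: a left `A`-module. -/
abbrev Dr (N : Type u) [AddCommGroup N] [Module Aᵐᵒᵖ N] : Type u := N →ₗ[Aᵐᵒᵖ] A

variable {A}

/-- The dual of a map of left modules. -/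
def dualMapL {M N : Type u} [AddCommGroup M] [Module A M] [AddCommGroup N] [Module A N]
    (g : M →ₗ[A] N) : Dl A N →ₗ[Aᵐᵒᵖ] Dl A M where
  toFun h := h.comp g
  map_add' h₁ h₂ := by ext; simp
  map_smul' a h := by ext; simp

/-- The dual of a map of right modules. -/
def dualMapR {M N : Type u} [AddCommGroup M] [Module Aᵐᵒᵖ M] [AddCommGroup N] [Module Aᵐᵒᵖ N]
    (g : M →ₗ[Aᵐᵒᵖ] N) : Dr A N →ₗ[A] Dr A M where
  toFun h := h.comp g
  map_add' h₁ h₂ := by ext; simp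
  map_smul' a h := by ext; simp

variable (A)

/-- The canonical evaluation map `φ_M : M → M**` for a left module `M`. -/
def evalL (M : Type u) [AddCommGroup M] [Module A M] : M →ₗ[A] Dr A (Dl A M) where
  toFun m :=
    { toFun := fun f => f m
      map_add' := fun f g => rfl
      map_smul' := fun a f => rfl }
  map_add' m m' := by ext f; simp
  map_smul' a m := by ext f; simp

/-- The canonical evaluation map `φ_N : N → N**` for a right module `N`. -/
def evalR (N : Type u) [AddCommGroup N] [Module Aᵐᵒᵖ N] : N →ₗ[Aᵐᵒᵖ] Dl A (Dr A N) where
  toFun n :=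
    { toFun := fun f => f n
      map_add' := fun f g => rfl
      map_smul' := fun a f => rfl }
  map_add' n n' := by ext f; simp
  map_smul' a n := by ext f; simp

/-- The radical of a module: the intersection of all maximal submodules. -/
def radM (M : Type u) [AddCommGroup M] [Module A M] : Submodule A M :=
  sInf {N : Submodule A M | IsCoatom N}

/-- A module is *reduced* if it has no nonzero projective direct summand. -/
def Reduced (M : Type u) [AddCommGroup M] [Module A M] : Prop :=
  ∀ N N' : Submodule A M, IsCompl N N' → Module.Projective A N → N = ⊥

/-- Vanishing of `Ext^i_A(M, N)`. -/
def extZero (M N : Type u) [AddCommGroup M] [Module A M] [AddCommGroup N] [Module A N]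
    (i : ℕ) : Prop :=
  Limits.IsZero (((Ext ℤ (ModuleCat.{u} A) i).obj (Opposite.op (ModuleCat.of A M))).obj
    (ModuleCat.of A N))

/-- A left module `M` is semi-Gorenstein-projective if `Ext^i_A(M, A) = 0` for all `i ≥ 1`. -/
def sGp (M : Type u) [AddCommGroup M] [Module A M] : Prop :=
  ∀ i : ℕ, 1 ≤ i → extZero A M A i

/-- Semi-Gorenstein-projectivity for right modules, with `A` as right regular module. -/
def sGpR (N : Type u) [AddCommGroup N] [Module Aᵐᵒᵖ N] : Prop :=
  ∀ i : ℕ, 1 ≤ i → extZero Aᵐᵒᵖ N A i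

/-- `e : P → M` is a projective cover: `P` is a finitely generated projective module,
`e` is surjective and `ker e ⊆ rad P`. -/
def IsProjCover {P M : Type u} [AddCommGroup P] [Module A P] [AddCommGroup M] [Module A M]
    (e : P →ₗ[A] M) : Prop :=
  Module.Projective A P ∧ Module.Finite A P ∧ Function.Surjective e ∧ ker e ≤ radM A P

/-- `P₁ →f P₀ →e M → 0` is a minimal projective presentation of `M`. -/
def IsMinPres {P₁ P₀ M : Type u} [AddCommGroup P₁] [Module A P₁] [AddCommGroup P₀] [Module A P₀]
    [AddCommGroup M] [Module A M] (f : P₁ →ₗ[A] P₀) (e : P₀ →ₗ[A] M) : Prop :=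
  IsProjCover A e ∧ range f = ker e ∧ Module.Projective A P₁ ∧ Module.Finite A P₁ ∧
    ker f ≤ radM A P₁

/-- A minimal projective resolution `⋯ → P₁ → P₀ → M → 0` (ℕ-indexed). -/
def IsMinProjRes (P : ℕ → Type u) [∀ n, AddCommGroup (P n)] [∀ n, Module A (P n)]
    {M : Type u} [AddCommGroup M] [Module A M]
    (f : ∀ n, P (n+1) →ₗ[A] P n) (e : P 0 →ₗ[A] M) : Prop :=
  (∀ n, Module.Projective A (P n)) ∧ (∀ n, Module.Finite A (P n)) ∧
    Function.Surjective e ∧ range (f 0) = ker e ∧ (∀ n, range (f (n+1)) = ker (f n)) ∧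
    ker e ≤ radM A (P 0) ∧ (∀ n, ker (f n) ≤ radM A (P (n+1)))

section ZComplex

variable (P : ℤ → Type u) [∀ i, AddCommGroup (P i)] [∀ i, Module A (P i)]
  (g : ∀ i : ℤ, P i →ₗ[A] P (i-1))

/-- `(P_i, g_i : P_i → P_{i-1})` is a complex. -/
def IsComplexZ : Prop := ∀ i : ℤ, (g (i-1)).comp (g i) = 0

/-- A complex is minimal if each image lies in the radical. -/
def IsMinimalZ : Prop := ∀ i : ℤ, range (g i) ≤ radM A (P (i-1))

/-- A complex of (finitely generated) projective modules. -/
def IsProjComplexZ : Prop := ∀ i : ℤ, Module.Projective A (P i) ∧ Module.Finite A (P i)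

/-- Exactness at position `i - 1`, i.e. `H_{i-1}(P_•) = 0`. -/
def ExactAtPred (i : ℤ) : Prop := range (g i) = ker (g (i-1))

/-- Acyclicity of the `A`-dual complex `P_•^*`. -/
def DualAcyclicZ : Prop :=
  ∀ i : ℤ, range (dualMapL (g (i-1))) = ker (dualMapL (g i))

/-- The homology of the complex at position `i - 1`. -/
abbrev HomologyAtPred (i : ℤ) : Type u :=
  ↥(ker (g (i-1))) ⧸ (Submodule.comap (ker (g (i-1))).subtype (range (g i)))

end ZComplex

/-- `Z` is (a representative of) the transpose `Tr M` of the left module `M`. -/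
def IsTrL (M : Type u) [AddCommGroup M] [Module A M]
    (Z : Type u) [AddCommGroup Z] [Module Aᵐᵒᵖ Z] : Prop :=
  ∃ (P₁ P₀ : ModuleCat.{u} A) (f : P₁ →ₗ[A] P₀) (e : P₀ →ₗ[A] M),
    IsMinPres A f e ∧ Nonempty (Z ≃ₗ[Aᵐᵒᵖ] (Dl A P₁ ⧸ range (dualMapL f)))

/-- `M` is (a representative of) the transpose `Tr Z` of the right module `Z`. -/
def IsTrR (Z : Type u) [AddCommGroup Z] [Module Aᵐᵒᵖ Z]
    (M : Type u) [AddCommGroup M] [Module A M] : Prop :=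
  ∃ (Q₁ Q₀ : ModuleCat.{u} Aᵐᵒᵖ) (d : Q₁ →ₗ[Aᵐᵒᵖ] Q₀) (c : Q₀ →ₗ[Aᵐᵒᵖ] Z),
    IsMinPres Aᵐᵒᵖ d c ∧ Nonempty (M ≃ₗ[A] (Dr A Q₁ ⧸ range (dualMapR d)))

/-- `W` is (a representative of) the syzygy `Ω M` of the left module `M`. -/
def IsSyzL (W M : Type u) [AddCommGroup W] [Module A W] [AddCommGroup M] [Module A M] : Prop :=
  ∃ (P : ModuleCat.{u} A) (e : P →ₗ[A] M),
    IsProjCover A e ∧ Nonempty (W ≃ₗ[A] ker e)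

/-- `W` is (a representative of) the syzygy `Ω Z` of the right module `Z`. -/
def IsSyzR (W Z : Type u) [AddCommGroup W] [Module Aᵐᵒᵖ W] [AddCommGroup Z] [Module Aᵐᵒᵖ Z] :
    Prop :=
  ∃ (Q : ModuleCat.{u} Aᵐᵒᵖ) (c : Q →ₗ[Aᵐᵒᵖ] Z),
    IsProjCover Aᵐᵒᵖ c ∧ Nonempty (W ≃ₗ[Aᵐᵒᵖ] ker c)

/-- `W` is a second syzygy `Ω² M`. -/
def IsSyz2L (W M : Type u) [AddCommGroup W] [Module A W] [AddCommGroup M] [Module A M] : Prop :=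
  ∃ (V : ModuleCat.{u} A), IsSyzL A V M ∧ IsSyzL A W V

/-- `W` is a second syzygy `Ω² Z` of a right module. -/
def IsSyz2R (W Z : Type u) [AddCommGroup W] [Module Aᵐᵒᵖ W] [AddCommGroup Z] [Module Aᵐᵒᵖ Z] :
    Prop :=
  ∃ (V : ModuleCat.{u} Aᵐᵒᵖ), IsSyzR A V Z ∧ IsSyzR A W V

/-- A right module `Z` is ∞-torsionfree if its transpose is semi-Gorenstein-projective. -/
def InfTfR (Z : Type u) [AddCommGroup Z] [Module Aᵐᵒᵖ Z] : Prop :=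
  ∃ (M : ModuleCat.{u} A), IsTrR A Z M ∧ sGp A M

/-- A left module `M` is ∞-torsionfree if its transpose is semi-Gorenstein-projective. -/
def InfTfL (M : Type u) [AddCommGroup M] [Module A M] : Prop :=
  ∃ (Z : ModuleCat.{u} Aᵐᵒᵖ), IsTrL A M Z ∧ sGpR A Z

/-- Projective dimension at most `n` (for objects of `ModuleCat A`). -/
def projDimLEcat : ℕ → ModuleCat.{u} A → Prop
  | 0, M => Module.Projective A M
  | (n+1), M => ∃ (P : ModuleCat.{u} A) (e : P →ₗ[A] M),
      Module.Projective A P ∧ Module.Finite A P ∧ Function.Surjective e ∧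
        projDimLEcat n (ModuleCat.of A (ker e))

/-- Projective dimension at most `n`. -/
def projDimLE (M : Type u) [AddCommGroup M] [Module A M] (n : ℕ) : Prop :=
  projDimLEcat A n (ModuleCat.of A M)

/-- A Nunke module: a semi-Gorenstein-projective module `M` with `M* = 0`. -/
def NunkeL (M : Type u) [AddCommGroup M] [Module A M] : Prop :=
  sGp A M ∧ ∀ f : Dl A M, f = 0

end Preliminaries


/-- The factor algebra `B = A / AeA`, the quotient of `A` by the two-sided ideal
generated by the idempotent `e`. -/
abbrev Bquot (A : Type u) [Ring A] (e : A) : Type u := (TwoSidedIdeal.span {e}).ringCon.Quotient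

/-- The quotient map `A → B = A/AeA`. -/
abbrev Bproj (A : Type u) [Ring A] (e : A) : A →+* Bquot A e := (TwoSidedIdeal.span {e}).ringCon.mk'

/-- `e` is a primitive idempotent of `A`. -/
def IsPrimIdem (A : Type u) [Ring A] (e : A) : Prop :=
  IsIdempotentElem e ∧ e ≠ 0 ∧
    ∀ a b : A, IsIdempotentElem a → IsIdempotentElem b → a * b = 0 → b * a = 0 →
      e = a + b → a = 0 ∨ b = 0

lemma radM_le_of_isCoatom {A M : Type u} [Ring A] [AddCommGroup M] [Module A M]
    {N : Submodule A M} (hN : IsCoatom N) : radM A M ≤ N :=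
  sInf_le hN

lemma eq_top_of_sup_eq_top_of_le_radM {A M : Type u} [Ring A] [AddCommGroup M] [Module A M]
    [Module.Finite A M] {N K : Submodule A M} (hK : K ≤ radM A M) (h : N ⊔ K = ⊤) : N = ⊤ := by
  by_contra hN
  obtain ⟨C, hC, hNC⟩ := (eq_top_or_exists_le_coatom N).resolve_left hN
  exact hC.1 (top_le_iff.1 (h ▸ sup_le hNC (hK.trans (radM_le_of_isCoatom hC))))

section SimpleTop

variable {A : Type u} [Ring A] {S : Type u} [AddCommGroup S] [Module A S]
  {PS : Type u} [AddCommGroup PS] [Module A PS] {eP : PS →ₗ[A] S}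

lemma IsProjCover.isCoatom_ker [IsSimpleModule A S] (hcov : IsProjCover A eP) :
    IsCoatom (ker eP) := by
  rw [← isSimpleModule_iff_isCoatom]
  exact IsSimpleModule.congr (eP.quotKerEquivOfSurjective hcov.2.2.1)

lemma IsProjCover.ker_eq_radM [IsSimpleModule A S] (hcov : IsProjCover A eP) :
    ker eP = radM A PS :=
  le_antisymm hcov.2.2.2 (radM_le_of_isCoatom hcov.isCoatom_ker)

lemma IsProjCover.eq_top_of_not_le [IsSimpleModule A S] (hcov : IsProjCover A eP)
    {N : Submodule A PS} (hN : ¬ N ≤ ker eP) : N = ⊤ := by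
  have := hcov.2.1
  refine eq_top_of_sup_eq_top_of_le_radM hcov.2.2.2 (hcov.isCoatom_ker.2 _ ?_)
  exact lt_of_le_of_ne le_sup_right fun h => hN (by rw [h]; exact le_sup_left)

/-- If `e` is a primitive idempotent not annihilating the simple module `S`, then `Ae` is a
projective cover of `S`: an isomorphism is given by `a ↦ a • x` and `σ`. -/
lemma IsProjCover.exists_section [IsSimpleModule A S] (hcov : IsProjCover A eP) {e : A}
    (he : IsPrimIdem A e) (heS : ∃ s : S, e • s ≠ 0) :
    ∃ (x : PS) (σ : PS →ₗ[A] A), e • x = x ∧ eP x ≠ 0 ∧ σ x = e ∧ ∀ y, σ y • x = y := by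
  obtain ⟨s, hs⟩ := heS
  obtain ⟨y, rfl⟩ := hcov.2.2.1 s
  have hee : e * e = e := he.1
  set x := e • y with hx
  have hex : e • x = x := by rw [hx, smul_smul, hee]
  have hx0 : eP x ≠ 0 := by rwa [hx, map_smul]
  have htop : range (LinearMap.toSpanSingleton A PS x) = ⊤ :=
    hcov.eq_top_of_not_le fun h => hx0 (h ⟨1, by simp⟩)
  have := hcov.1
  obtain ⟨τ, hτ⟩ := (LinearMap.toSpanSingleton A PS x).exists_rightInverse_of_surjective htop
  replace hτ : ∀ z, τ z • x = z := fun z => LinearMap.congr_fun hτ z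
  let σ : PS →ₗ[A] A := (LinearMap.toSpanSingleton A A e).comp τ
  have hσe : ∀ z, σ z = τ z * e := fun z => rfl
  have hσ : ∀ z, σ z • x = z := fun z => by rw [hσe, mul_smul, hex, hτ]
  have h1 : e * σ x = σ x := by rw [← smul_eq_mul, ← map_smul, hex]
  have h2 : σ x * e = σ x := by rw [hσe, mul_assoc, hee]
  have h3 : σ x * σ x = σ x := by rw [← smul_eq_mul, ← map_smul, hσ]
  refine ⟨x, σ, hex, hx0, ?_, hσ⟩
  have h4 : e = σ x + (e - σ x) := by abel
  rcases he.2.2 (σ x) (e - σ x) h3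
    (by simp only [IsIdempotentElem, mul_sub, sub_mul, h1, h2, h3, hee, sub_self, sub_zero])
    (by rw [mul_sub, h2, h3, sub_self]) (by rw [sub_mul, h1, h3, sub_self]) h4 with h | h
  · exact absurd (by rw [← hσ x, h, zero_smul, map_zero]) hx0
  · exact (sub_eq_zero.1 h).symm

lemma IsProjCover.mul_eq_zero_of_mem_annihilator [IsSimpleModule A S] (hcov : IsProjCover A eP)
    (hinj : Module.Injective A S) {e : A}
    (he : IsPrimIdem A e) (heS : ∃ s : S, e • s ≠ 0) {q : A} (hq : ∀ s : S, q • s = 0) :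
    e * q = 0 := by
  obtain ⟨x, σ, hex, hx0, hσx, -⟩ := hcov.exists_section he heS
  by_contra h0
  let g : PS →ₗ[A] A := (LinearMap.toSpanSingleton A A q).comp σ
  have hgx : g x = e * q := by rw [← hσx]; rfl
  have hker : ker g ≤ ker eP := by
    by_contra hk
    have := hcov.eq_top_of_not_le hk
    exact h0 (by rw [← hgx]; exact LinearMap.mem_ker.1 (this ▸ Submodule.mem_top))
  obtain ⟨h, hh⟩ := hinj.out ((ker g).liftQ g le_rfl)
    (LinearMap.ker_eq_bot.1 (Submodule.ker_liftQ_eq_bot _ _ _ le_rfl)) ((ker g).liftQ eP hker)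
  have h1 : h (e * q) = eP x := by
    have := hh (Submodule.Quotient.mk x)
    simpa [hgx] using this
  apply hx0
  rw [← h1, ← mul_one (e * q), ← smul_eq_mul, map_smul, mul_smul, hq, smul_zero]

end SimpleTop

/-- A finitely generated module over an artin algebra which is simple and not annihilated by a
two-sided ideal `I` is acted upon as the identity by some element of `I`. -/
lemma exists_mem_forall_smul_eq (k : Type u) [CommRing k] {A : Type u} [Ring A] [Algebra k A]
    [Module.Finite k A] (S : Type u) [AddCommGroup S] [Module A S] [IsSimpleModule A S]
    (I : TwoSidedIdeal A) (hI : ∃ r ∈ I, ∃ s : S, r • s ≠ 0) :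
    ∃ r ∈ I, ∀ s : S, r • s = s := by
  obtain ⟨r₀, hr₀, s₀, hs₀⟩ := hI
  have hs0 : s₀ ≠ 0 := by rintro rfl; simp at hs₀
  obtain ⟨n, b, hb⟩ := Module.Finite.exists_fin (R := k) (M := A)
  let v : Fin n → S := fun i => b i • s₀
  let V : Submodule A (Fin n → S) :=
    Submodule.map (LinearMap.toSpanSingleton A (Fin n → S) v) (TwoSidedIdeal.asIdeal I)
  obtain ⟨W, hW⟩ := exists_isCompl V
  obtain ⟨x, hx, w, hw, hxw⟩ := Submodule.mem_sup.1
    (hW.sup_eq_top ▸ Submodule.mem_top : v ∈ V ⊔ W)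
  obtain ⟨r, hr, rfl⟩ := hx
  replace hr : r ∈ I := hr
  replace hxw : r • v + w = v := hxw
  have hIw : ∀ t ∈ I, t • w = 0 := by
    intro t ht
    have h1 : t • w ∈ V := by
      have h2 : w = (1 - r) • v := by rw [sub_smul, one_smul, eq_sub_iff_add_eq, add_comm, hxw]
      rw [h2, smul_smul]
      exact ⟨_, I.mul_mem_right _ _ ht, rfl⟩
    exact (Submodule.disjoint_def.1 hW.disjoint) _ h1 (W.smul_mem _ hw)
  have hw0 : w = 0 := by
    funext i
    by_contra hi
    obtain ⟨a, ha⟩ := IsSimpleModule.toSpanSingleton_surjective A hi s₀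
    replace ha : a • w i = s₀ := ha
    apply hs₀
    rw [← ha, smul_smul]
    exact congrFun (hIw _ (I.mul_mem_right _ _ hr₀)) i
  rw [hw0, add_zero] at hxw
  refine ⟨r, hr, fun s => ?_⟩
  obtain ⟨a, rfl⟩ := IsSimpleModule.toSpanSingleton_surjective A hs0 s
  have ha : a ∈ Submodule.span k (Set.range b) := hb ▸ Submodule.mem_top
  change r • a • s₀ = a • s₀
  induction ha using Submodule.span_induction with
  | mem _ h => obtain ⟨i, rfl⟩ := h; exact congrFun hxw i
  | zero => simp
  | add _ _ _ _ h₁ h₂ => rw [add_smul, smul_add, h₁, h₂]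
  | smul c a _ h =>
    rw [Algebra.smul_def, mul_smul, smul_smul, ← Algebra.commutes, mul_smul, h]

/-- If `S` is simple injective with projective cover `Ae`, then the two-sided ideal `AeA` is a
direct summand of the left module `A`. -/
lemma IsProjCover.exists_mem_span_and_mul_eq_zero (k : Type u) [CommRing k] {A : Type u} [Ring A]
    [Algebra k A] [Module.Finite k A] {S : Type u} [AddCommGroup S] [Module A S]
    [IsSimpleModule A S] {PS : Type u} [AddCommGroup PS] [Module A PS] {eP : PS →ₗ[A] S}
    (hcov : IsProjCover A eP) (hinj : Module.Injective A S) {e : A}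
    (he : IsPrimIdem A e) (heS : ∃ s : S, e • s ≠ 0) :
    ∃ q : A, 1 - q ∈ TwoSidedIdeal.span {e} ∧ ∀ a ∈ TwoSidedIdeal.span {e}, a * q = 0 := by
  obtain ⟨r, hr, hrS⟩ := exists_mem_forall_smul_eq k S (TwoSidedIdeal.span {e})
    ⟨e, TwoSidedIdeal.subset_span rfl, heS⟩
  have hq : ∀ s : S, (1 - r) • s = 0 := fun s => by rw [sub_smul, one_smul, hrS, sub_self]
  refine ⟨1 - r, by simpa using hr, fun a ha => ?_⟩
  revert hq
  generalize 1 - r = q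
  induction ha using TwoSidedIdeal.span_induction generalizing q with
  | mem a h =>
    obtain rfl : a = e := h
    exact hcov.mul_eq_zero_of_mem_annihilator hinj he heS
  | zero => simp
  | add _ _ _ _ h₁ h₂ => intro hq; rw [add_mul, h₁ _ hq, h₂ _ hq, add_zero]
  | neg _ _ h => intro hq; rw [neg_mul, h _ hq, neg_zero]
  | left_absorb a _ _ h => intro hq; rw [mul_assoc, h _ hq, mul_zero]
  | right_absorb b a _ h =>
    intro hq
    rw [mul_assoc]
    exact h _ fun s => by rw [mul_smul, hq, smul_zero]

/-- The complex `Hom(K, Y)` is exact at degree `n + 1`. -/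
def HomExactAt {C : Type*} [Category* C] [Abelian C] (K : ChainComplex C ℕ) (n : ℕ)
    (Y : C) : Prop :=
  ∀ φ : K.X (n + 1) ⟶ Y, K.d (n + 2) (n + 1) ≫ φ = 0 →
    ∃ ψ : K.X n ⟶ Y, K.d (n + 1) n ≫ ψ = φ

lemma CategoryTheory.ProjectiveResolution.isZero_Ext_succ_iff (R : Type*) [Ring R] {C : Type*}
    [Category* C] [Abelian C] [Linear R C] [EnoughProjectives C] {X : C}
    (P : ProjectiveResolution X) (Y : C) (n : ℕ) :
    Limits.IsZero (((Ext R C (n + 1)).obj (Opposite.op X)).obj Y) ↔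
      HomExactAt P.complex n Y := by
  rw [(P.isoExt (R := R) (n + 1) Y).isZero_iff, ← HomologicalComplex.exactAt_iff_isZero_homology,
    HomologicalComplex.exactAt_iff' _ n (n + 1) (n + 2) (by simp) (by simp),
    ShortComplex.moduleCat_exact_iff]
  exact Iff.rfl

namespace HomExactAt

variable {C : Type*} [Category* C] [Abelian C] {K : ChainComplex C ℕ} {n : ℕ}

lemma of_retract {Y Y' : C} (h : HomExactAt K n Y) (r : Retract Y' Y) : HomExactAt K n Y' := by
  intro φ hφ
  obtain ⟨ψ, hψ⟩ := h (φ ≫ r.i) (by rw [← Category.assoc, hφ, Limits.zero_comp])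
  exact ⟨ψ ≫ r.r, by rw [← Category.assoc, hψ, Category.assoc, r.retract, Category.comp_id]⟩

lemma iff_of_mono {Y Y' : C} (ι : Y' ⟶ Y) [Mono ι]
    (hι : ∀ (m : ℕ) (φ : K.X m ⟶ Y), ∃ φ', φ' ≫ ι = φ) :
    HomExactAt K n Y' ↔ HomExactAt K n Y := by
  constructor
  · intro h φ hφ
    obtain ⟨φ', rfl⟩ := hι _ φ
    obtain ⟨ψ, hψ⟩ := h φ' (by rw [← cancel_mono ι, Category.assoc, hφ, Limits.zero_comp])
    exact ⟨ψ ≫ ι, by rw [← Category.assoc, hψ]⟩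
  · intro h φ hφ
    obtain ⟨ψ, hψ⟩ := h (φ ≫ ι) (by rw [← Category.assoc, hφ, Limits.zero_comp])
    obtain ⟨ψ', rfl⟩ := hι _ ψ
    exact ⟨ψ', by rw [← cancel_mono ι, Category.assoc, hψ]⟩

lemma map_iff {D : Type*} [Category* D] [Abelian D] (F : C ⥤ D) [F.Additive] [F.Full] [F.Faithful]
    (Y : C) :
    HomExactAt ((F.mapHomologicalComplex _).obj K) n (F.obj Y) ↔ HomExactAt K n Y := by
  constructor
  · intro h φ hφ
    obtain ⟨ψ, hψ⟩ := h (F.map φ) (by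
      change F.map _ ≫ F.map φ = 0
      rw [← F.map_comp, hφ, F.map_zero])
    obtain ⟨ψ', rfl⟩ := F.map_surjective ψ
    exact ⟨ψ', F.map_injective (by rw [F.map_comp]; exact hψ)⟩
  · intro h φ hφ
    obtain ⟨φ', rfl⟩ := F.map_surjective φ
    obtain ⟨ψ, hψ⟩ := h φ' (F.map_injective (by rw [F.map_comp, F.map_zero]; exact hφ))
    exact ⟨F.map ψ, by rw [← hψ, F.map_comp]; rfl⟩

end HomExactAt

lemma ModuleCat.restrictScalars_full_of_surjective {A B : Type u} [Ring A] [Ring B] {f : A →+* B}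
    (hf : Function.Surjective f) : (ModuleCat.restrictScalars.{u} f).Full where
  map_surjective {M N} g := by
    refine ⟨ModuleCat.ofHom
      { toFun := fun x => g.hom x
        map_add' := fun x y => g.hom.map_add x y
        map_smul' := fun b x => ?_ }, rfl⟩
    obtain ⟨a, rfl⟩ := hf b
    exact g.hom.map_smul a x

lemma Module.Projective.trans_of_isScalarTower (A : Type*) {B P : Type*} [Ring A] [Ring B]
    [AddCommGroup P] [Module A B] [Module B P] [Module A P] [IsScalarTower A B P]
    [IsScalarTower A B B] [Module.Projective A B] [Module.Projective B P] :
    Module.Projective A P := by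
  obtain ⟨s, hs⟩ := Module.projective_def'.1 ‹Module.Projective B P›
  classical
  have : Module.Projective A (P →₀ B) := .of_equiv' (finsuppLequivDFinsupp A).symm
  exact Module.Projective.of_split (M := P →₀ B) (s.restrictScalars A)
    ((Finsupp.linearCombination B id).restrictScalars A)
    (LinearMap.ext fun x => LinearMap.congr_fun hs x)

/-- If `B` is projective as an `A`-module, then restriction of scalars preserves projectives. -/
lemma ModuleCat.restrictScalars_preservesProjectiveObjects {A B : Type u} [Ring A] [Ring B]
    {f : A →+* B}
    (hf : Projective ((ModuleCat.restrictScalars.{u} f).obj (ModuleCat.of B B))) :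
    (ModuleCat.restrictScalars.{u} f).PreservesProjectiveObjects where
  projective_obj {P} hP := by
    have hP' : Module.Projective B P := inferInstance
    let _ := Module.compHom B f
    have hB : Module.Projective A B := (IsProjective.iff_projective (R := A) B).2 hf
    let _ := Module.compHom P f
    have : IsScalarTower A B B := ⟨fun a b x => mul_assoc (f a) b x⟩
    have : IsScalarTower A B P := ⟨fun a b x => mul_smul (f a) b x⟩
    exact (IsProjective.iff_projective (R := A) P).1 (.trans_of_isScalarTower A (B := B))

lemma ModuleCat.restrictScalars_preservesHomology {A B : Type u} [Ring A] [Ring B]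
    (f : A →+* B) : (ModuleCat.restrictScalars.{u} f).PreservesHomology := by
  refine ((Functor.exact_tfae (ModuleCat.restrictScalars.{u} f)).out 1 2).1 fun S h => ?_
  rw [ShortComplex.ShortExact.moduleCat_exact_iff_function_exact] at h ⊢
  exact h

/-- If the complement of `AeA` in `A` is generated by `q`, then `A/AeA` is a retract of the left
module `A`. -/
lemma nonempty_retract_Bquot {A : Type u} [Ring A] {e q : A}
    (hq : 1 - q ∈ TwoSidedIdeal.span {e}) (hIq : ∀ a ∈ TwoSidedIdeal.span {e}, a * q = 0) :
    ∃ r : Retract ((ModuleCat.restrictScalars.{u} (Bproj A e)).obj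
      (ModuleCat.of (Bquot A e) (Bquot A e))) (ModuleCat.of A A),
      ∀ a : A, r.i.hom (r.r.hom a) = a * q := by
  have hmk : ∀ a b : A, Bproj A e a = Bproj A e b ↔ a - b ∈ TwoSidedIdeal.span {e} := by
    intro a b
    rw [← TwoSidedIdeal.rel_iff]
    exact RingCon.eq _
  let F := (ModuleCat.restrictScalars.{u} (Bproj A e)).obj
      (ModuleCat.of (Bquot A e) (Bquot A e))
  let p : A →ₗ[A] F :=
    { toFun := fun a => Bproj A e a
      map_add' := fun a b => map_add (Bproj A e) a b
      map_smul' := fun a b => map_mul (Bproj A e) a b }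
  have hp : Function.Surjective p := Quotient.mk''_surjective
  have hker : ker p ≤ ker (LinearMap.toSpanSingleton A A q) := fun a ha => by
    refine hIq a ?_
    have h : Bproj A e a = Bproj A e 0 := (LinearMap.mem_ker.1 ha).trans (map_zero _).symm
    rw [hmk, sub_zero] at h
    exact h
  let i : F →ₗ[A] A := ((ker p).liftQ _ hker).comp (p.quotKerEquivOfSurjective hp).symm.toLinearMap
  have hip : ∀ a, i (p a) = a * q := fun a => by
    have : (p.quotKerEquivOfSurjective hp).symm (p a) = Submodule.Quotient.mk a := by
      rw [LinearEquiv.symm_apply_eq]; rfl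
    simp [i, this]
  refine ⟨⟨ModuleCat.ofHom (X := F) i, ModuleCat.ofHom (Y := F) p, ?_⟩, hip⟩
  refine ModuleCat.hom_ext (LinearMap.ext fun x => ?_)
  obtain ⟨a, rfl⟩ := hp x
  change p (i (p a)) = p a
  rw [hip]
  change Bproj A e (a * q) = Bproj A e a
  rw [hmk, show a * q - a = a * -(1 - q) by noncomm_ring]
  exact TwoSidedIdeal.mul_mem_left _ _ _ (TwoSidedIdeal.neg_mem _ hq)

/-- The elements `a` such that right multiplication by `a` sends cocycles in `Hom(K, A)` to
coboundaries form a two-sided ideal. -/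
def boundaryIdeal {A : Type u} [Ring A] (K : ChainComplex (ModuleCat.{u} A) ℕ) (n : ℕ) :
    TwoSidedIdeal A :=
  .mk' {a | ∀ φ : K.X (n + 1) ⟶ ModuleCat.of A A, K.d (n + 2) (n + 1) ≫ φ = 0 →
      ∃ ψ : K.X n ⟶ ModuleCat.of A A,
        K.d (n + 1) n ≫ ψ = φ ≫ ModuleCat.ofHom (LinearMap.toSpanSingleton A A a)}
    (fun φ _ => ⟨0, by ext; simp⟩)
    (fun {a b} ha hb φ hφ => by
      obtain ⟨ψ, hψ⟩ := ha φ hφ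
      obtain ⟨ψ', hψ'⟩ := hb φ hφ
      exact ⟨ψ + ψ', by rw [Preadditive.comp_add, hψ, hψ']; ext; simp [mul_add]⟩)
    (fun {a} ha φ hφ => by
      obtain ⟨ψ, hψ⟩ := ha φ hφ
      exact ⟨-ψ, by rw [Preadditive.comp_neg, hψ]; ext; simp⟩)
    (fun {a b} hb φ hφ => by
      obtain ⟨ψ, hψ⟩ := hb (φ ≫ ModuleCat.ofHom (LinearMap.toSpanSingleton A A a))
        (by rw [← Category.assoc, hφ, Limits.zero_comp])
      exact ⟨ψ, by rw [hψ]; ext; simp [mul_assoc]⟩)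
    (fun {a b} ha φ hφ => by
      obtain ⟨ψ, hψ⟩ := ha φ hφ
      exact ⟨ψ ≫ ModuleCat.ofHom (LinearMap.toSpanSingleton A A b),
        by rw [← Category.assoc, hψ]; ext; simp [mul_assoc]⟩)

lemma mem_boundaryIdeal {A : Type u} [Ring A] {K : ChainComplex (ModuleCat.{u} A) ℕ} {n : ℕ}
    {a : A} : a ∈ boundaryIdeal K n ↔
      ∀ φ : K.X (n + 1) ⟶ ModuleCat.of A A, K.d (n + 2) (n + 1) ≫ φ = 0 →
        ∃ ψ : K.X n ⟶ ModuleCat.of A A,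
          K.d (n + 1) n ≫ ψ = φ ≫ ModuleCat.ofHom (LinearMap.toSpanSingleton A A a) := by
  rw [boundaryIdeal, TwoSidedIdeal.mem_mk']
  exact Iff.rfl

lemma one_mem_boundaryIdeal_iff {A : Type u} [Ring A] {K : ChainComplex (ModuleCat.{u} A) ℕ}
    {n : ℕ} : 1 ∈ boundaryIdeal K n ↔ HomExactAt K n (ModuleCat.of A A) := by
  have : ModuleCat.ofHom (LinearMap.toSpanSingleton A A 1) = 𝟙 (ModuleCat.of A A) := by
    ext; simp
  simp only [mem_boundaryIdeal, this, Category.comp_id, HomExactAt]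

lemma HomExactAt.mem_boundaryIdeal {A : Type u} [Ring A] {K : ChainComplex (ModuleCat.{u} A) ℕ}
    {n : ℕ} {Y : ModuleCat.{u} A} (h : HomExactAt K n Y) {a : A} (f : ModuleCat.of A A ⟶ Y)
    (g : Y ⟶ ModuleCat.of A A) (hfg : ∀ x : A, g.hom (f.hom x) = x * a) :
    a ∈ boundaryIdeal K n := by
  rw [_root_.mem_boundaryIdeal]
  intro φ hφ
  obtain ⟨ψ, hψ⟩ := h (φ ≫ f) (by rw [← Category.assoc, hφ, Limits.zero_comp])
  refine ⟨ψ ≫ g, ?_⟩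
  rw [← Category.assoc, hψ]
  ext x
  simp [hfg]

/-- The idempotent `e` acts as zero on modules over `A/AeA`. -/
lemma smul_restrictScalars_Bproj_eq_zero {A : Type u} [Ring A] {e : A}
    (N : ModuleCat.{u} (Bquot A e)) (x : (ModuleCat.restrictScalars (Bproj A e)).obj N) :
    e • x = 0 := by
  have h : Bproj A e e = 0 := by
    rw [← map_zero (Bproj A e)]
    refine (RingCon.eq _).2 ?_
    rw [TwoSidedIdeal.rel_iff, sub_zero]
    exact TwoSidedIdeal.subset_span rfl
  change Bproj A e e • (show N from x) = 0
  rw [h, zero_smul]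

lemma comp_eq_zero_of_smul_ne_zero {A : Type u} [Ring A] {S N : Type u} [AddCommGroup S]
    [Module A S] [IsSimpleModule A S] [AddCommGroup N] [Module A N] {e : A}
    (heS : ∃ s : S, e • s ≠ 0) (hN : ∀ x : N, e • x = 0) (f : N →ₗ[A] S) : f = 0 := by
  rcases eq_bot_or_eq_top (range f) with h | h
  · exact LinearMap.range_eq_bot.1 h
  · obtain ⟨s, hs⟩ := heS
    obtain ⟨x, rfl⟩ := LinearMap.range_eq_top.1 h s
    exact absurd (by rw [← map_smul, hN, map_zero]) hs

/-- 3.6(d): a `B`-module `U` is semi-Gorenstein-projective as an `A`-module iff it is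
semi-Gorenstein-projective as a `B`-module and `Ext^i_B(U, M) = 0` for all `i ≥ 1`,
where `M = Ω S = rad P(S)`. -/
theorem sgp_over_A_iff_over_B (k : Type u) [CommRing k] [IsArtinianRing k]
    (A : Type u) [Ring A] [Algebra k A] [Module.Finite k A]
    (e₀ : A) (he₀ : IsPrimIdem A e₀)
    (S : Type u) [AddCommGroup S] [Module A S] [Module.Finite A S]
    (hsimple : IsSimpleModule A S) (hinjective : Module.Injective A S)
    (heS : ∃ s : S, e₀ • s ≠ 0)
    (PS : Type u) [AddCommGroup PS] [Module A PS]
    (eP : PS →ₗ[A] S) (hcov : IsProjCover A eP)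
    (M' : ModuleCat.{u} (Bquot A e₀))
    (hM' : Nonempty ((↥((ModuleCat.restrictScalars (Bproj A e₀)).obj M')) ≃ₗ[A]
      ↥(radM A PS)))
    (U : ModuleCat.{u} (Bquot A e₀)) (hU : Module.Finite (Bquot A e₀) (↥U)) :
    sGp A (↥((ModuleCat.restrictScalars (Bproj A e₀)).obj U)) ↔
      (sGp (Bquot A e₀) (↥U) ∧
        ∀ i : ℕ, 1 ≤ i → extZero (Bquot A e₀) (↥U) (↥M') i) := by
  obtain ⟨j⟩ := hM'
  obtain ⟨x, σ, hex, -, hσx, hσ⟩ := hcov.exists_section he₀ heS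
  obtain ⟨q, hq, hIq⟩ := hcov.exists_mem_span_and_mul_eq_zero k hinjective he₀ heS
  obtain ⟨rB, hrB⟩ := nonempty_retract_Bquot hq hIq
  let F := ModuleCat.restrictScalars.{u} (Bproj A e₀)
  have hfull : F.Full := ModuleCat.restrictScalars_full_of_surjective Quotient.mk''_surjective
  have hA : Projective (ModuleCat.of A A) :=
    (IsProjective.iff_projective (R := A) A).1 inferInstance
  have hproj : F.PreservesProjectiveObjects :=
    ModuleCat.restrictScalars_preservesProjectiveObjects (rB.projective)
  have hpres : F.PreservesHomology := ModuleCat.restrictScalars_preservesHomology _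
  let P : ProjectiveResolution U := projectiveResolution U
  let Q : ProjectiveResolution (F.obj U) := F.mapProjectiveResolution P
  let l : F.obj M' →ₗ[A] PS := (radM A PS).subtype.comp j.toLinearMap
  let ι : F.obj M' ⟶ ModuleCat.of A PS := ModuleCat.ofHom (X := F.obj M') l
  have hι : Mono ι := (ModuleCat.mono_iff_injective _).2
    (Subtype.val_injective.comp j.injective)
  have hfac : ∀ (m : ℕ) (φ : Q.complex.X m ⟶ ModuleCat.of A PS), ∃ φ', φ' ≫ ι = φ := by
    intro m φ
    have h0 : eP.comp φ.hom = 0 := comp_eq_zero_of_smul_ne_zero heS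
      (fun y => smul_restrictScalars_Bproj_eq_zero (P.complex.X m) y) _
    have h1 : ∀ y, φ.hom y ∈ radM A PS := fun y => by
      rw [← hcov.ker_eq_radM]
      exact LinearMap.congr_fun h0 y
    refine ⟨ModuleCat.ofHom (X := Q.complex.X m) (Y := F.obj M') (j.symm.toLinearMap.comp (φ.hom.codRestrict _ h1)), ?_⟩
    exact ModuleCat.hom_ext (LinearMap.ext fun y =>
      congrArg Subtype.val (j.apply_symm_apply ⟨φ.hom y, h1 y⟩))
  let f : ModuleCat.of A A ⟶ ModuleCat.of A PS :=
    ModuleCat.ofHom (LinearMap.toSpanSingleton A PS x)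
  let g : ModuleCat.of A PS ⟶ ModuleCat.of A A := ModuleCat.ofHom σ
  let rPS : Retract (ModuleCat.of A PS) (ModuleCat.of A A) :=
    ⟨g, f, by ext y; exact hσ y⟩
  have key (n : ℕ) : HomExactAt Q.complex n (ModuleCat.of A A) ↔
      HomExactAt P.complex n (ModuleCat.of _ (Bquot A e₀)) ∧ HomExactAt P.complex n M' := by
    rw [← HomExactAt.map_iff F (ModuleCat.of _ (Bquot A e₀)), ← HomExactAt.map_iff F M']
    change _ ↔ HomExactAt Q.complex n _ ∧ HomExactAt Q.complex n _
    rw [HomExactAt.iff_of_mono ι hfac]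
    refine ⟨fun h => ⟨h.of_retract rB, h.of_retract rPS⟩, fun ⟨h₁, h₂⟩ => ?_⟩
    have hq' : q ∈ boundaryIdeal Q.complex n := h₁.mem_boundaryIdeal rB.r rB.i hrB
    have he : e₀ ∈ boundaryIdeal Q.complex n := h₂.mem_boundaryIdeal f g fun a => by
      change σ (a • x) = _
      rw [map_smul, hσx, smul_eq_mul]
    have hspan : TwoSidedIdeal.span {e₀} ≤ boundaryIdeal Q.complex n :=
      TwoSidedIdeal.span_le.2 (by simpa using he)
    rw [← one_mem_boundaryIdeal_iff, ← sub_add_cancel 1 q]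
    exact TwoSidedIdeal.add_mem _ (hspan hq) hq'
  have hext (i : ℕ) (hi : 1 ≤ i) : extZero A (F.obj U) A i ↔
      extZero (Bquot A e₀) U (Bquot A e₀) i ∧ extZero (Bquot A e₀) U M' i := by
    obtain ⟨n, rfl⟩ := Nat.exists_eq_add_of_le' hi
    exact (Q.isZero_Ext_succ_iff ℤ _ n).trans ((key n).trans
      (and_congr (P.isZero_Ext_succ_iff ℤ _ n) (P.isZero_Ext_succ_iff ℤ _ n)).symm)
  exact (forall₂_congr hext).trans forall₂_and
end

section
/- Let S be a simple injective left A-module with End(S) = D, let e be a primitive idempotent of A with eS ≠ 0, B = A/AeA, and M = Ω S = rad P(S). The following are equivalent: (i) S is semi-Gorenstein-projective (as an A-module); (ii) M is a Nunke B-module, Ext^i_B(M, M) = 0 for all i ≥ 1, and either M = 0 or End(M) is isomorphic to D as a k-algebra. -/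
/-!
Common background: `A` is an artin algebra (an algebra over a commutative artinian
ring `k`, finitely generated as `k`-module).  Left `A`-modules are `Module A M`;
right `A`-modules are `Module Aᵐᵒᵖ N`.  `Dl A M = Hom_A(M,A)` is the `A`-dual of a
left module (a right module) and `Dr A N` the dual of a right module (a left module);
`evalL A M : M → M**` is the canonical evaluation map `φ_M`.
-/

open CategoryTheory LinearMap

universe u

/-- For `c : k`, the central `A`-linear endomorphism `x ↦ (algebraMap k A c) • x`.
These maps give the `k`-algebra structure on `End_A(X)`; a ring isomorphism of
endomorphism rings is a `k`-algebra isomorphism iff it matches them up. -/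
def centralSMul (k A : Type u) [CommRing k] [Ring A] [Algebra k A] (c : k)
    (X : Type u) [AddCommGroup X] [Module A X] : Module.End A X where
  toFun x := algebraMap k A c • x
  map_add' x y := smul_add _ x y
  map_smul' a x := by simp only [RingHom.id_apply, ← mul_smul, Algebra.commutes]

section ExtBridge

variable {A : Type u} [Ring A]

lemma hasExt_moduleCat (A : Type u) [Ring A] : HasExt.{u} (ModuleCat.{u} A) :=
  hasExt_of_enoughProjectives _

attribute [local instance] hasExt_moduleCat

/-- Vanishing of the derived-functor `Ext` groups in positive degree, expressed
through Yoneda-type `Ext` groups. -/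
lemma extZero_succ_iff_subsingleton (M N : Type u) [AddCommGroup M] [Module A M]
    [AddCommGroup N] [Module A N] (n : ℕ) :
    extZero A M N (n + 1) ↔
      Subsingleton (Abelian.Ext.{u} (ModuleCat.of A M) (ModuleCat.of A N) (n + 1)) := by
  let R := ProjectiveResolution.of (ModuleCat.of A M)
  trans ∀ f : R.complex.X (n + 1) ⟶ ModuleCat.of A N, R.complex.d (n + 2) (n + 1) ≫ f = 0 →
      ∃ g : R.complex.X n ⟶ ModuleCat.of A N, R.complex.d (n + 1) n ≫ g = f
  · unfold extZero
    rw [(R.isoExt (R := ℤ) (n + 1) (ModuleCat.of A N)).isZero_iff,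
      ← HomologicalComplex.exactAt_iff_isZero_homology,
      HomologicalComplex.exactAt_iff' _ n (n + 1) (n + 2) (by simp) (by simp),
      ShortComplex.moduleCat_exact_iff]
    rfl
  · constructor
    · intro h
      refine subsingleton_of_forall_eq 0 fun α => ?_
      obtain ⟨f, hf, rfl⟩ := R.extMk_surjective α (n + 2) rfl
      exact (R.extMk_eq_zero_iff f _ rfl hf n rfl).2 (h f hf)
    · intro h f hf
      exact (R.extMk_eq_zero_iff f _ rfl hf n rfl).1 (Subsingleton.elim _ _)

variable {K P M : Type u} [AddCommGroup K] [Module A K] [AddCommGroup P] [Module A P]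
  [AddCommGroup M] [Module A M] {i : K →ₗ[A] P} {q : P →ₗ[A] M}

lemma shortExact_of_linearMap (hi : Function.Injective i) (hex : Function.Exact i q)
    (hq : Function.Surjective q) :
    (ShortComplex.mk (ModuleCat.ofHom i) (ModuleCat.ofHom q)
      (by ext x; exact hex.apply_apply_eq_zero x)).ShortExact where
  exact := (ShortComplex.ShortExact.moduleCat_exact_iff_function_exact _).2 hex
  mono_f := (ModuleCat.mono_iff_injective _).2 hi
  epi_g := (ModuleCat.epi_iff_surjective _).2 hq

lemma extZero_one_iff (hi : Function.Injective i) (hex : Function.Exact i q)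
    (hq : Function.Surjective q) [Module.Projective A P]
    (N : Type u) [AddCommGroup N] [Module A N] :
    extZero A M N 1 ↔ ∀ f : K →ₗ[A] N, ∃ g : P →ₗ[A] N, g ∘ₗ i = f := by
  rw [extZero_succ_iff_subsingleton]
  have hS := shortExact_of_linearMap hi hex hq
  have : Projective (ModuleCat.of A P) := ModuleCat.projective_of_categoryTheory_projective _
  constructor
  · intro h f
    obtain ⟨x, hx⟩ := Abelian.Ext.contravariant_sequence_exact₁ hS _
      (Abelian.Ext.mk₀ (ModuleCat.ofHom f)) (n₁ := 1) rfl (Subsingleton.elim _ _)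
    obtain ⟨g, rfl⟩ := (Abelian.Ext.mk₀_bijective _ _).2 x
    rw [Abelian.Ext.mk₀_comp_mk₀] at hx
    have := (Abelian.Ext.mk₀_bijective _ _).1 hx
    exact ⟨g.hom, congrArg ModuleCat.Hom.hom this⟩
  · intro h
    refine subsingleton_of_forall_eq 0 fun α => ?_
    obtain ⟨x, rfl⟩ := Abelian.Ext.contravariant_sequence_exact₃ hS _ α
      (Abelian.Ext.eq_zero_of_projective _) (n₀ := 0) rfl
    obtain ⟨f, rfl⟩ := (Abelian.Ext.mk₀_bijective _ _).2 x
    obtain ⟨g, hg⟩ := h f.hom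
    have : f = ModuleCat.ofHom i ≫ ModuleCat.ofHom g := by
      ext x; exact (LinearMap.congr_fun hg x).symm
    rw [this, ← Abelian.Ext.mk₀_comp_mk₀]
    exact hS.extClass_comp_assoc _

lemma extZero_add_two_iff (hi : Function.Injective i) (hex : Function.Exact i q)
    (hq : Function.Surjective q) [Module.Projective A P]
    (N : Type u) [AddCommGroup N] [Module A N] (n : ℕ) :
    extZero A M N (n + 2) ↔ extZero A K N (n + 1) := by
  rw [extZero_succ_iff_subsingleton, extZero_succ_iff_subsingleton]
  have hS := shortExact_of_linearMap hi hex hq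
  have : Projective (ModuleCat.of A P) := ModuleCat.projective_of_categoryTheory_projective _
  constructor
  · intro h
    refine subsingleton_of_forall_eq 0 fun α => ?_
    obtain ⟨x, rfl⟩ := Abelian.Ext.contravariant_sequence_exact₁ hS _ α (n₁ := n + 2)
      (by omega) (Subsingleton.elim _ _)
    rw [Abelian.Ext.eq_zero_of_projective x, Abelian.Ext.comp_zero]
  · intro h
    refine subsingleton_of_forall_eq 0 fun α => ?_
    obtain ⟨x, rfl⟩ := Abelian.Ext.contravariant_sequence_exact₃ hS _ α
      (Abelian.Ext.eq_zero_of_projective _) (n₀ := n + 1) (by omega)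
    rw [Subsingleton.elim x 0, Abelian.Ext.comp_zero]

end ExtBridge

section ExtRetract

variable {A : Type u} [Ring A]

lemma ker_subtype_exact {P M : Type u} [AddCommGroup P] [Module A P]
    [AddCommGroup M] [Module A M] (q : P →ₗ[A] M) : Function.Exact (ker q).subtype q := by
  intro x; simp

/-- The canonical surjection from a free module is `Finsupp.linearCombination A id`. -/
lemma linearCombination_id_surjective (A M : Type u) [Ring A] [AddCommGroup M] [Module A M] :
    Function.Surjective (Finsupp.linearCombination A (id : M → M)) :=
  fun x => ⟨Finsupp.single x 1, by simp⟩

lemma extZero_succ_of_retract {N N' : Type u} [AddCommGroup N] [Module A N]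
    [AddCommGroup N'] [Module A N'] (s : N →ₗ[A] N') (r : N' →ₗ[A] N) (hrs : ∀ x, r (s x) = x)
    (n : ℕ) (M : Type u) [AddCommGroup M] [Module A M] (h : extZero A M N' (n + 1)) :
    extZero A M N (n + 1) := by
  induction n generalizing M with
  | zero =>
    rw [extZero_one_iff (Submodule.subtype_injective _) (ker_subtype_exact _)
      (linearCombination_id_surjective A M)] at h ⊢
    intro f
    obtain ⟨g, hg⟩ := h (s ∘ₗ f)
    refine ⟨r ∘ₗ g, ?_⟩
    rw [LinearMap.comp_assoc, hg]
    ext x; exact hrs _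
  | succ n ih =>
    rw [extZero_add_two_iff (Submodule.subtype_injective _) (ker_subtype_exact _)
      (linearCombination_id_surjective A M)] at h ⊢
    exact ih _ h

lemma extZero_succ_prod {N N' : Type u} [AddCommGroup N] [Module A N]
    [AddCommGroup N'] [Module A N'] (n : ℕ) (M : Type u) [AddCommGroup M] [Module A M]
    (h : extZero A M N (n + 1)) (h' : extZero A M N' (n + 1)) :
    extZero A M (N × N') (n + 1) := by
  induction n generalizing M with
  | zero =>
    rw [extZero_one_iff (Submodule.subtype_injective _) (ker_subtype_exact _)
      (linearCombination_id_surjective A M)] at h h' ⊢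
    intro f
    obtain ⟨g, hg⟩ := h (LinearMap.fst A N N' ∘ₗ f)
    obtain ⟨g', hg'⟩ := h' (LinearMap.snd A N N' ∘ₗ f)
    refine ⟨g.prod g', ?_⟩
    ext x
    · exact LinearMap.congr_fun hg x
    · exact LinearMap.congr_fun hg' x
  | succ n ih =>
    rw [extZero_add_two_iff (Submodule.subtype_injective _) (ker_subtype_exact _)
      (linearCombination_id_surjective A M)] at h h' ⊢
    exact ih _ h h'

lemma extZero_succ_pi {N : Type u} [AddCommGroup N] [Module A N] {ι : Type} (n : ℕ)
    (M : Type u) [AddCommGroup M] [Module A M] (h : extZero A M N (n + 1)) :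
    extZero A M (ι → N) (n + 1) := by
  induction n generalizing M with
  | zero =>
    rw [extZero_one_iff (Submodule.subtype_injective _) (ker_subtype_exact _)
      (linearCombination_id_surjective A M)] at h ⊢
    intro f
    choose g hg using fun i : ι => h (LinearMap.proj i ∘ₗ f)
    refine ⟨LinearMap.pi g, ?_⟩
    ext x i
    exact LinearMap.congr_fun (hg i) x
  | succ n ih =>
    rw [extZero_add_two_iff (Submodule.subtype_injective _) (ker_subtype_exact _)
      (linearCombination_id_surjective A M)] at h ⊢
    exact ih _ h

lemma LinearMap.exists_comp_eq_of_range_le {X Y Z : Type u} [AddCommGroup X] [AddCommGroup Y]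
    [AddCommGroup Z] [Module A X] [Module A Y] [Module A Z] {i : Y →ₗ[A] Z}
    (hi : Function.Injective i) {g : X →ₗ[A] Z} (h : ∀ x, g x ∈ range i) :
    ∃ l : X →ₗ[A] Y, i ∘ₗ l = g := by
  refine ⟨(LinearEquiv.ofInjective i hi).symm ∘ₗ g.codRestrict _ h, ?_⟩
  ext x
  exact congrArg Subtype.val ((LinearEquiv.ofInjective i hi).apply_symm_apply ⟨g x, h x⟩)

lemma LinearMap.exists_comp_eq_of_ker_le {X Y Z : Type u} [AddCommGroup X] [AddCommGroup Y]
    [AddCommGroup Z] [Module A X] [Module A Y] [Module A Z] {g : X →ₗ[A] Y}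
    (hg : Function.Surjective g) {g' : X →ₗ[A] Z} (h : ker g ≤ ker g') :
    ∃ l : Y →ₗ[A] Z, ∀ x, l (g x) = g' x :=
  ⟨(ker g).liftQ g' h ∘ₗ (g.quotKerEquivOfSurjective hg).symm.toLinearMap, fun x => by
    have : (g.quotKerEquivOfSurjective hg).symm (g x) = Submodule.Quotient.mk x := by
      rw [LinearEquiv.symm_apply_eq]; rfl
    rw [LinearMap.comp_apply, LinearEquiv.coe_coe, this, Submodule.liftQ_apply]⟩

end ExtRetract

section ChangeOfRings

variable {A B : Type u} [Ring A] [Ring B] (f : A →+* B)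

/-- A map that is linear over `A` is linear over a quotient ring `B` of `A`. -/
def linearMapOfSurjective (hf : Function.Surjective f) {X Y : Type u} [AddCommGroup X]
    [AddCommGroup Y] [Module A X] [Module B X] [Module A Y] [Module B Y]
    (hX : ∀ (a : A) (x : X), a • x = f a • x) (hY : ∀ (a : A) (y : Y), a • y = f a • y)
    (g : X →ₗ[A] Y) : X →ₗ[B] Y where
  toFun := g
  map_add' := map_add g
  map_smul' b x := by
    obtain ⟨a, rfl⟩ := hf b
    rw [← hX, map_smul, hY, RingHom.id_apply]

/-- Restriction of scalars of a linear map along a ring homomorphism. -/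
def linearMapRestrict {X Y : Type u} [AddCommGroup X]
    [AddCommGroup Y] [Module A X] [Module B X] [Module A Y] [Module B Y]
    (hX : ∀ (a : A) (x : X), a • x = f a • x) (hY : ∀ (a : A) (y : Y), a • y = f a • y)
    (g : X →ₗ[B] Y) : X →ₗ[A] Y where
  toFun := g
  map_add' := map_add g
  map_smul' a x := by rw [hX, map_smul, hY, RingHom.id_apply]

lemma exists_presentation [Module A B] (hB : ∀ a (b : B), a • b = f a • b)
    [Module.Projective A B] (X : Type u) [AddCommGroup X] [Module B X] :
    ∃ (K F : Type u) (_ : AddCommGroup K) (_ : AddCommGroup F) (_ : Module A K) (_ : Module B K)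
      (_ : Module A F) (_ : Module B F) (_ : Module.Projective A F) (_ : Module.Projective B F)
      (i : K →ₗ[B] F) (q : F →ₗ[B] X), (∀ (a : A) (x : K), a • x = f a • x) ∧
      (∀ (a : A) (x : F), a • x = f a • x) ∧ Function.Injective i ∧ Function.Exact i q ∧
      Function.Surjective q := by
  classical
  have : Module.Projective A (X →₀ B) := .of_equiv (finsuppLequivDFinsupp (ι := X) (M := B) A).symm
  exact ⟨ker (Finsupp.linearCombination B (id : X → X)), X →₀ B, inferInstance, inferInstance,
    Module.compHom _ f, inferInstance, inferInstance, inferInstance, this, inferInstance,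
    (ker (Finsupp.linearCombination B (id : X → X))).subtype, Finsupp.linearCombination B id,
    fun _ _ => rfl, fun a z => by ext x; exact hB _ _, Submodule.subtype_injective _,
    ker_subtype_exact _, linearCombination_id_surjective B X⟩

/-- If `B` is a quotient ring of `A` that is projective as an `A`-module, and `Y` is the largest
submodule of the `A`-module `Y'` that is a `B`-module, then `Ext_A(X, Y')` vanishes if and only if
`Ext_B(X, Y)` does, for every `B`-module `X`. -/
lemma extZero_iff_of_surjective (hf : Function.Surjective f) [Module A B]
    (hB : ∀ a (b : B), a • b = f a • b) [Module.Projective A B]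
    {Y Y' : Type u} [AddCommGroup Y] [AddCommGroup Y'] [Module A Y] [Module B Y] [Module A Y']
    (hY : ∀ (a : A) (y : Y), a • y = f a • y) (j : Y →ₗ[A] Y') (hj : Function.Injective j)
    (hrange : ∀ y, (∀ a, f a = 0 → a • y = 0) → y ∈ range j)
    (n : ℕ) (X : Type u) [AddCommGroup X] [Module A X] [Module B X]
    (hX : ∀ (a : A) (x : X), a • x = f a • x) :
    extZero A X Y' (n + 1) ↔ extZero B X Y (n + 1) := by
  have hlift : ∀ (Z : Type u) [AddCommGroup Z] [Module A Z] [Module B Z],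
      (∀ (a : A) (z : Z), a • z = f a • z) → ∀ g : Z →ₗ[A] Y', ∃ g' : Z →ₗ[A] Y, j ∘ₗ g' = g := by
    intro Z _ _ _ hZ g
    have hg : ∀ z, g z ∈ range j := fun z => hrange _ fun a ha => by
      rw [← map_smul, hZ, ha, zero_smul, map_zero]
    exact LinearMap.exists_comp_eq_of_range_le hj hg
  induction n generalizing X with
  | zero =>
    obtain ⟨K, F, _, _, _, _, _, _, _, _, i, q, hK, hF, hi, hex, hq⟩ := exists_presentation f hB X
    rw [extZero_one_iff hi hex hq, extZero_one_iff (i := linearMapRestrict f hK hF i)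
      (q := linearMapRestrict f hF hX q) hi hex hq]
    constructor
    · intro h g
      obtain ⟨g', hg'⟩ := h (j ∘ₗ linearMapRestrict f hK hY g)
      obtain ⟨g'', rfl⟩ := hlift _ hF g'
      refine ⟨linearMapOfSurjective f hf hF hY g'', ?_⟩
      ext x
      exact hj (LinearMap.congr_fun hg' x)
    · intro h g
      obtain ⟨g', rfl⟩ := hlift _ hK g
      obtain ⟨g'', hg''⟩ := h (linearMapOfSurjective f hf hK hY g')
      refine ⟨j ∘ₗ linearMapRestrict f hF hY g'', ?_⟩
      ext x
      exact congrArg j (LinearMap.congr_fun hg'' x)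
  | succ n ih =>
    obtain ⟨K, F, _, _, _, _, _, _, _, _, i, q, hK, hF, hi, hex, hq⟩ := exists_presentation f hB X
    rw [extZero_add_two_iff hi hex hq, extZero_add_two_iff (i := linearMapRestrict f hK hF i)
      (q := linearMapRestrict f hF hX q) hi hex hq]
    exact ih _ hK

end ChangeOfRings

section SimpleCover

variable {A : Type u} [Ring A]

lemma smul_eq_zero_of_mem_span {e : A} {X : Type u} [AddCommGroup X] [Module A X]
    (hX : ∀ x : X, e • x = 0) {a : A} (ha : a ∈ TwoSidedIdeal.span {e}) (x : X) : a • x = 0 := by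
  have h : TwoSidedIdeal.span {e} ≤ TwoSidedIdeal.ker (Module.toAddMonoidEnd A X) :=
    TwoSidedIdeal.span_le.2 <| Set.singleton_subset_iff.2 <|
      (TwoSidedIdeal.mem_ker _).2 <| AddMonoidHom.ext hX
  exact DFunLike.congr_fun ((TwoSidedIdeal.mem_ker _).1 (h ha)) x

/-- A projective cover `eP : PS → S` together with an element `q` of `e PS` on which `eP` does not
vanish, where `e` is a primitive idempotent. -/
structure IsPointedCover {PS S : Type u} [AddCommGroup PS] [Module A PS] [AddCommGroup S]
    [Module A S] (e : A) (eP : PS →ₗ[A] S) (q : PS) : Prop where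
  isPrimIdem : IsPrimIdem A e
  isProjCover : IsProjCover A eP
  smul_eq : e • q = q
  apply_ne : eP q ≠ 0

lemma IsProjCover.exists_isPointedCover {PS S : Type u} [AddCommGroup PS] [Module A PS]
    [AddCommGroup S] [Module A S] {e : A} {eP : PS →ₗ[A] S} (h : IsProjCover A eP)
    (he : IsPrimIdem A e) (heS : ∃ s : S, e • s ≠ 0) : ∃ q, IsPointedCover e eP q := by
  obtain ⟨s, hs⟩ := heS
  obtain ⟨p, rfl⟩ := h.2.2.1 s
  exact ⟨e • p, he, h, by rw [← mul_smul, he.1.eq], by rwa [map_smul]⟩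

namespace IsPointedCover

variable {PS S : Type u} [AddCommGroup PS] [Module A PS] [AddCommGroup S] [Module A S]
  [IsSimpleModule A S] {e : A} {eP : PS →ₗ[A] S} {q : PS} (h : IsPointedCover e eP q)

include h

lemma radM_eq_ker : radM A PS = ker eP :=
  le_antisymm (sInf_le (isCoatom_ker_of_surjective h.isProjCover.2.2.1)) h.isProjCover.2.2.2

lemma eq_top_of_not_le {N : Submodule A PS} (hN : ¬ N ≤ ker eP) : N = ⊤ := by
  have := h.isProjCover.2.1
  by_contra hne
  obtain ⟨N', hN', hle⟩ := (eq_top_or_exists_le_coatom N).resolve_left hne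
  have h1 : ker eP ≤ N' := h.isProjCover.2.2.2.trans (sInf_le hN')
  have h2 := isCoatom_ker_of_surjective h.isProjCover.2.2.1
  rcases h2.le_iff.1 h1 with h3 | h3
  · exact hN'.1 h3
  · exact hN (h3 ▸ hle)

lemma span_eq_top {p : PS} (hp : eP p ≠ 0) : Submodule.span A {p} = ⊤ :=
  h.eq_top_of_not_le fun hle => hp (hle (Submodule.mem_span_singleton_self p))

lemma hom_eq_zero {X : Type u} [AddCommGroup X] [Module A X] {g : PS →ₗ[A] X} (hg : g q = 0) :
    g = 0 :=
  ker_eq_top.1 <| h.eq_top_of_not_le fun hle => h.apply_ne (hle hg)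

lemma hom_eq_zero_of_smul {X : Type u} [AddCommGroup X] [Module A X] (hX : ∀ x : X, e • x = 0)
    (g : PS →ₗ[A] X) : g = 0 :=
  h.hom_eq_zero <| by rw [← h.smul_eq, map_smul, hX]

lemma exists_splitting : ∃ s : PS →ₗ[A] A, (∀ p, s p • q = p) ∧ s q * e = e := by
  have := h.isProjCover.1
  have hsurj : Function.Surjective (toSpanSingleton A PS q) := by
    rw [← range_eq_top, range_toSpanSingleton, h.span_eq_top h.apply_ne]
  obtain ⟨s, hs⟩ := Module.projective_lifting_property (toSpanSingleton A PS q) LinearMap.id hsurj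
  have hs' : ∀ p, s p • q = p := fun p => LinearMap.congr_fun hs p
  refine ⟨s, hs', ?_⟩
  have he : e * e = e := h.isPrimIdem.1
  have h1 : e * s q = s q := by rw [← smul_eq_mul, ← map_smul, h.smul_eq]
  have h2 : s q * s q = s q := by rw [← smul_eq_mul, ← map_smul, hs']
  have h3 : (s q * e) * (s q * e) = s q * e := by
    rw [mul_assoc, ← mul_assoc e, h1, ← mul_assoc, h2]
  have h4 : e * (s q * e) = s q * e := by rw [← mul_assoc, h1]
  have h5 : (s q * e) * e = s q * e := by rw [mul_assoc, he]
  rcases h.isPrimIdem.2.2 (s q * e) (e - s q * e) h3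
    (by rw [IsIdempotentElem, sub_mul, mul_sub, mul_sub, he, h3, h4, h5]; abel)
    (by rw [mul_sub, h5, h3, sub_self]) (by rw [sub_mul, h4, h3, sub_self]) (by abel) with h6 | h6
  · refine absurd ?_ h.apply_ne
    have : q = (s q * e) • q := by rw [mul_smul, h.smul_eq, hs']
    rw [this, h6, zero_smul, map_zero]
  · exact (sub_eq_zero.1 h6).symm

lemma exists_hom {X : Type u} [AddCommGroup X] [Module A X] {x : X} (hx : e • x = x) :
    ∃ g : PS →ₗ[A] X, g q = x := by
  obtain ⟨s, -, hs⟩ := h.exists_splitting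
  exact ⟨toSpanSingleton A X x ∘ₗ s, by
    rw [LinearMap.comp_apply, toSpanSingleton_apply]; nth_rw 1 [← hx]; rw [← mul_smul, hs, hx]⟩

lemma mem_ker_of_smul_eq_zero {y : PS} (hy : ∀ a : A, (e * a) • y = 0) : y ∈ ker eP := by
  by_contra hne
  obtain ⟨a, ha⟩ := Submodule.mem_span_singleton.1 (h.span_eq_top hne ▸ Submodule.mem_top (x := q))
  refine h.apply_ne ?_
  rw [← h.smul_eq, ← ha, ← mul_smul, hy, map_zero]

variable [Module.Injective A S]

lemma smul_eq_zero_of_hom_eq_zero {C : Type u} [AddCommGroup C] [Module A C]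
    (hC : ∀ φ : C →ₗ[A] S, φ = 0) (c : C) : e • c = 0 := by
  by_contra hc
  obtain ⟨g, hg⟩ := h.exists_hom (x := e • c) (by rw [← mul_smul, h.isPrimIdem.1.eq])
  have hle : ker g ≤ ker eP := by
    by_contra hle
    exact hc (by rw [← hg, ker_eq_top.1 (h.eq_top_of_not_le hle), LinearMap.zero_apply])
  obtain ⟨φ, hφ⟩ := Module.Injective.out ((ker g).liftQ g le_rfl)
    (ker_eq_bot.1 (Submodule.ker_liftQ_eq_bot _ _ _ le_rfl)) ((ker g).liftQ eP hle)
  have := hφ (Submodule.Quotient.mk q)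
  rw [hC φ, LinearMap.zero_apply, Submodule.liftQ_apply] at this
  exact h.apply_ne this.symm

lemma smul_eq_zero_of_mem_ker {x : PS} (hx : x ∈ ker eP) : e • x = 0 := by
  refine congrArg Subtype.val (h.smul_eq_zero_of_hom_eq_zero (C := ker eP) (fun φ => ?_) ⟨x, hx⟩)
  obtain ⟨ψ, hψ⟩ := Module.Injective.out (ker eP).subtype (Submodule.subtype_injective _) φ
  ext y
  rw [← hψ, LinearMap.zero_apply]
  rcases LinearMap.surjective_or_eq_zero ψ with hs | rfl
  · exact (h.isProjCover.2.2.2.trans (sInf_le (isCoatom_ker_of_surjective hs))) y.2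
  · rfl

/-- A projective left ideal is a direct sum of copies of `PS` and a module annihilated by `e`. -/
lemma exists_equiv_of_projective [IsArtinianRing A] (N : Submodule A A)
    (hN : Module.Projective A N) :
    ∃ (n : ℕ) (C : Submodule A A), (∀ c : C, e • c = 0) ∧
      Nonempty (N ≃ₗ[A] (Fin n → PS) × C) := by
  induction N using WellFoundedLT.induction with
  | ind N ih =>
  have hPS := h.isProjCover.1
  by_cases h0 : ∀ φ : N →ₗ[A] S, φ = 0
  · exact ⟨0, N, h.smul_eq_zero_of_hom_eq_zero h0, ⟨LinearEquiv.uniqueProd.symm⟩⟩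
  push Not at h0
  obtain ⟨φ, hφ⟩ := h0
  obtain ⟨ψ, hψ⟩ := Module.projective_lifting_property eP φ h.isProjCover.2.2.1
  have hψs : Function.Surjective ψ := by
    rw [← range_eq_top]
    refine h.eq_top_of_not_le fun hle => hφ ?_
    rw [← hψ]
    ext x
    exact hle ⟨x, rfl⟩
  obtain ⟨s, hs⟩ := Module.projective_lifting_property ψ LinearMap.id hψs
  let E : N ≃ₗ[A] ker ψ × PS := (Function.Exact.splitSurjectiveEquiv (ker_subtype_exact ψ)
    (Submodule.subtype_injective _) ⟨s, hs⟩).1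
  let E' := Submodule.equivSubtypeMap N (ker ψ)
  have hker : Module.Projective A (ker ψ) :=
    .of_split (E.symm.toLinearMap ∘ₗ LinearMap.inl A (ker ψ) PS)
      (LinearMap.fst A (ker ψ) PS ∘ₗ E.toLinearMap) (by ext x; simp)
  have hlt : (ker ψ).map N.subtype < N := by
    refine lt_of_le_of_ne (Submodule.map_subtype_le _ _) fun heq => ?_
    obtain ⟨x, hx⟩ := hψs q
    obtain ⟨y, hy, hyx⟩ := heq.ge x.2
    rw [Subtype.ext hyx, SetLike.mem_coe, LinearMap.mem_ker, hx] at hy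
    exact h.apply_ne (by rw [hy, map_zero])
  obtain ⟨n, C, hC, ⟨θ⟩⟩ := ih _ hlt (.of_equiv E')
  exact ⟨n + 1, C, hC, ⟨E ≪≫ₗ LinearEquiv.prodComm A _ _ ≪≫ₗ
    (LinearEquiv.refl A PS).prodCongr (E' ≪≫ₗ θ) ≪≫ₗ (LinearEquiv.prodAssoc A _ _ _).symm ≪≫ₗ
    (Fin.consLinearEquiv A fun _ => PS).prodCongr (LinearEquiv.refl A C)⟩⟩

end IsPointedCover

end SimpleCover

section QuotientRing

variable {A : Type u} [Ring A]

variable {B : Type u} [Ring B] {f : A →+* B} [Module A B]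

namespace IsPointedCover

variable {PS S : Type u} [AddCommGroup PS] [Module A PS] [AddCommGroup S] [Module A S]
  [IsSimpleModule A S] {e : A} {eP : PS →ₗ[A] S} {q : PS} (h : IsPointedCover e eP q)
  [Module.Injective A S] [IsArtinianRing A]
  (hf : Function.Surjective f) (hker : ∀ a, f a = 0 ↔ a ∈ TwoSidedIdeal.span {e})
  (hB : ∀ a (b : B), a • b = f a • b)

include h hf hker hB

/-- The quotient `B = A / AeA` is, as an `A`-module, the complement of the copies of `PS`
in `A`. -/
lemma exists_equiv_and_retracts :
    ∃ (n : ℕ) (C : Submodule A A) (_ : A ≃ₗ[A] (Fin n → PS) × C) (σ : B →ₗ[A] A)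
      (u : C →ₗ[A] B) (v : B →ₗ[A] C), (∀ b, f (σ b) = b) ∧ ∀ c, v (u c) = c := by
  obtain ⟨n, C, hC, ⟨θ'⟩⟩ := h.exists_equiv_of_projective ⊤
    (.of_equiv (Submodule.topEquiv (R := A) (M := A)).symm)
  let θ : A ≃ₗ[A] (Fin n → PS) × C := Submodule.topEquiv.symm ≪≫ₗ θ'
  let fl : A →ₗ[A] B := toSpanSingleton A B 1
  have hfl : ∀ a, fl a = f a := fun a => by simp [fl, hB]
  let α : A →ₗ[A] C := LinearMap.snd A _ _ ∘ₗ θ.toLinearMap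
  let β : C →ₗ[A] A := θ.symm.toLinearMap ∘ₗ LinearMap.inr A _ _
  have hαβ : ∀ c, α (β c) = c := fun c => by simp [α, β]
  have hα : ker fl ≤ ker α := fun a ha => by
    rw [LinearMap.mem_ker, hfl, hker] at ha
    rw [LinearMap.mem_ker, ← mul_one a, ← smul_eq_mul, map_smul]
    exact smul_eq_zero_of_mem_span hC ha _
  obtain ⟨v, hv⟩ := LinearMap.exists_comp_eq_of_ker_le (fun b => by
    obtain ⟨a, rfl⟩ := hf b; exact ⟨a, hfl a⟩) hα
  have heB : ∀ b : B, e • b = 0 := fun b => by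
    rw [hB, (hker e).2 (TwoSidedIdeal.subset_span rfl), zero_smul]
  have h0 : fl ∘ₗ θ.symm.toLinearMap ∘ₗ LinearMap.inl A _ _ = 0 := by
    refine LinearMap.pi_ext' fun i => ?_
    rw [h.hom_eq_zero_of_smul heB (_ ∘ₗ _), LinearMap.zero_comp]
  have hβα : ∀ a, fl (β (α a)) = fl a := fun a => by
    have h1 : fl (θ.symm ((θ a).1, 0)) = 0 := LinearMap.congr_fun h0 (θ a).1
    have h2 : β (α a) = a - θ.symm ((θ a).1, 0) := by
      rw [← θ.apply_eq_iff_eq, map_sub]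
      ext <;> simp [α, β]
    rw [h2, map_sub, h1, sub_zero]
  refine ⟨n, C, θ, β ∘ₗ v, fl ∘ₗ β, v, fun b => ?_, fun c => ?_⟩
  · obtain ⟨a, rfl⟩ := hf b
    rw [← hfl, ← hfl, LinearMap.comp_apply, hv, hβα]
  · rw [LinearMap.comp_apply, hv, hαβ]

lemma projective_quotient : Module.Projective A B := by
  obtain ⟨-, -, -, σ, -, -, hσ, -⟩ := h.exists_equiv_and_retracts hf hker hB
  exact .of_split σ (toSpanSingleton A B 1) (by ext b; simp [hB, hσ])

lemma extZero_succ_self_iff (n : ℕ) (X : Type u) [AddCommGroup X] [Module A X] :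
    extZero A X A (n + 1) ↔ extZero A X PS (n + 1) ∧ extZero A X B (n + 1) := by
  obtain ⟨m, C, θ, σ, u, v, hσ, huv⟩ := h.exists_equiv_and_retracts hf hker hB
  obtain ⟨s, hs, -⟩ := h.exists_splitting
  constructor
  · exact fun hA => ⟨extZero_succ_of_retract s (toSpanSingleton A PS q) hs n X hA,
      extZero_succ_of_retract σ (toSpanSingleton A B 1) (fun b => by simp [hB, hσ]) n X hA⟩
  · rintro ⟨hPS, hB'⟩
    exact extZero_succ_of_retract θ.toLinearMap θ.symm.toLinearMap θ.symm_apply_apply n X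
      (extZero_succ_prod n X (extZero_succ_pi n X hPS) (extZero_succ_of_retract u v huv n X hB'))

end IsPointedCover

end QuotientRing

section EndomorphismRings

lemma surjective_of_injective_of_map_centralSMul {k A S : Type u} [CommRing k] [IsArtinianRing k]
    [Ring A] [Algebra k A] [Module.Finite k A] [AddCommGroup S] [Module A S] [IsSimpleModule A S]
    (φ : Module.End A S →+* Module.End A S) (hφ : Function.Injective φ)
    (hc : ∀ c, φ (centralSMul k A c S) = centralSMul k A c S) : Function.Surjective φ := by
  let : Module k S := Module.compHom S (algebraMap k A)
  have : IsScalarTower k A S := ⟨fun c a s => by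
    rw [Algebra.smul_def, mul_smul]; rfl⟩
  have : SMulCommClass A k S := ⟨fun a c s => ((centralSMul k A c S).map_smul a s).symm⟩
  have : Module.Finite k S := .trans A S
  have := IsSimpleModule.nontrivial A S
  obtain ⟨s, hs⟩ := exists_ne (0 : S)
  let ev : Module.End A S →ₗ[k] S :=
    { toFun := fun σ => σ s, map_add' := fun _ _ => rfl, map_smul' := fun _ _ => rfl }
  have hev : Function.Injective ev := by
    refine (injective_iff_map_eq_zero _).2 fun σ hσ => ?_
    refine (σ.injective_or_eq_zero).resolve_left fun hinj => hs (hinj ?_)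
    rw [map_zero]; exact hσ
  have := isArtinian_of_injective ev hev
  let φk : Module.End A S →ₗ[k] Module.End A S :=
    { toFun := φ
      map_add' := map_add φ
      map_smul' := fun c σ => by
        change φ (centralSMul k A c S * σ) = centralSMul k A c S * φ σ
        rw [map_mul, hc] }
  exact IsArtinian.surjective_of_injective_endomorphism φk hφ

lemma surjective_iff_exists_ringEquiv {k A S M : Type u} [CommRing k] [IsArtinianRing k]
    [Ring A] [Algebra k A] [Module.Finite k A] [AddCommGroup S] [Module A S] [IsSimpleModule A S]
    [AddCommGroup M] [Module A M] (ρ : Module.End A S →+* Module.End A M)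
    (hc : ∀ c, ρ (centralSMul k A c S) = centralSMul k A c M) :
    Function.Surjective ρ ↔ Subsingleton M ∨ ∃ φ : Module.End A M ≃+* Module.End A S,
      ∀ c : k, φ (centralSMul k A c M) = centralSMul k A c S := by
  classical
  have hinj [Nontrivial M] : Function.Injective ρ := RingHom.injective ρ
  constructor
  · intro hs
    refine or_iff_not_imp_left.2 fun hM => ?_
    have := not_subsingleton_iff_nontrivial.1 hM
    refine ⟨(RingEquiv.ofBijective ρ ⟨hinj, hs⟩).symm, fun c => ?_⟩
    rw [RingEquiv.symm_apply_eq]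
    exact (hc c).symm
  · rintro (hM | ⟨φ, hφ⟩) μ
    · exact ⟨0, LinearMap.ext fun _ => Subsingleton.elim _ _⟩
    · have := IsSimpleModule.nontrivial A S
      have : Nontrivial M := by
        by_contra hM
        rw [not_nontrivial_iff_subsingleton] at hM
        exact not_subsingleton (Module.End A S) φ.symm.toEquiv.subsingleton
      obtain ⟨σ, hσ⟩ := surjective_of_injective_of_map_centralSMul (k := k)
        ((φ : Module.End A M →+* Module.End A S).comp ρ) (φ.injective.comp hinj)
        (fun c => by simp [hc, hφ]) (φ μ)
      exact ⟨σ, φ.injective hσ⟩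

end EndomorphismRings

section Syzygy

variable {A : Type u} [Ring A]

namespace IsPointedCover

variable {PS S : Type u} [AddCommGroup PS] [Module A PS] [AddCommGroup S] [Module A S]
  [IsSimpleModule A S] {e : A} {eP : PS →ₗ[A] S} {q : PS} (h : IsPointedCover e eP q)
  [Module.Injective A S]

include h

variable {M : Type u} [AddCommGroup M] [Module A M] {i : M →ₗ[A] PS}
  (hi : Function.Injective i) (hex : Function.Exact i eP)

include hi hex

/-- Endomorphisms of `S` lift uniquely to its projective cover, and hence act on its syzygy. -/
lemma exists_ringHom_end :
    ∃ ρ : Module.End A S →+* Module.End A M, ∀ σ μ, ρ σ = μ ↔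
      ∃ p : PS →ₗ[A] PS, (∀ x, eP (p x) = σ (eP x)) ∧ ∀ m, p (i m) = i (μ m) := by
  have hPS := h.isProjCover.1
  have huniq : ∀ p p' : PS →ₗ[A] PS, (∀ x, eP (p x) = eP (p' x)) → p = p' := fun p p' hp => by
    rw [← sub_eq_zero]
    refine h.hom_eq_zero ?_
    rw [← h.smul_eq, map_smul]
    exact h.smul_eq_zero_of_mem_ker (by simp [hp])
  have hex1 : ∀ σ : Module.End A S, ∃ μ : Module.End A M, ∃ p : PS →ₗ[A] PS,
      (∀ x, eP (p x) = σ (eP x)) ∧ ∀ m, p (i m) = i (μ m) := fun σ => by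
    obtain ⟨p, hp⟩ := Module.projective_lifting_property eP (σ ∘ₗ eP) h.isProjCover.2.2.1
    have hp' : ∀ x, eP (p x) = σ (eP x) := LinearMap.congr_fun hp
    obtain ⟨μ, hμ⟩ := LinearMap.exists_comp_eq_of_range_le hi (g := p ∘ₗ i) fun m =>
      (hex _).1 (by rw [LinearMap.comp_apply, hp', hex.apply_apply_eq_zero, map_zero])
    exact ⟨μ, p, hp', fun m => (LinearMap.congr_fun hμ m).symm⟩
  choose μ p hp hμ using hex1
  have hchar : ∀ σ ν, μ σ = ν ↔
      ∃ p : PS →ₗ[A] PS, (∀ x, eP (p x) = σ (eP x)) ∧ ∀ m, p (i m) = i (ν m) := fun σ ν => by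
    refine ⟨fun hν => hν ▸ ⟨p σ, hp σ, hμ σ⟩, fun ⟨p', hp', hν⟩ => ?_⟩
    have : p σ = p' := huniq _ _ fun x => by rw [hp, hp']
    ext m
    exact hi (by rw [← hμ, ← hν, this])
  refine ⟨{ toFun := μ, map_one' := ?_, map_mul' := ?_, map_zero' := ?_, map_add' := ?_ }, hchar⟩
  · exact (hchar _ _).2 ⟨LinearMap.id, fun _ => rfl, fun _ => rfl⟩
  · exact fun σ τ => (hchar _ _).2 ⟨p σ ∘ₗ p τ, fun x => by simp [hp], fun m => by simp [hμ]⟩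
  · exact (hchar _ _).2 ⟨0, fun _ => by simp, fun _ => by simp⟩
  · exact fun σ τ => (hchar _ _).2 ⟨p σ + p τ, fun x => by simp [hp], fun m => by simp [hμ]⟩

lemma extZero_one_cover_iff (heM : ∀ m : M, e • m = 0) (k : Type u) [CommRing k]
    [IsArtinianRing k] [Algebra k A] [Module.Finite k A] :
    extZero A S PS 1 ↔ Subsingleton M ∨ ∃ φ : Module.End A M ≃+* Module.End A S,
      ∀ c : k, φ (centralSMul k A c M) = centralSMul k A c S := by
  have hPS := h.isProjCover.1
  obtain ⟨ρ, hρ⟩ := h.exists_ringHom_end hi hex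
  rw [← surjective_iff_exists_ringEquiv ρ fun c => (hρ _ _).2
    ⟨centralSMul k A c PS, fun x => map_smul eP _ x, fun m => (map_smul i _ m).symm⟩,
    extZero_one_iff hi hex h.isProjCover.2.2.1]
  constructor
  · intro hs μ
    obtain ⟨g, hg⟩ := hs (i ∘ₗ μ)
    have hg' : ∀ m, g (i m) = i (μ m) := LinearMap.congr_fun hg
    obtain ⟨σ, hσ⟩ := LinearMap.exists_comp_eq_of_ker_le h.isProjCover.2.2.1
      (g' := eP ∘ₗ g) fun x hx => by
        obtain ⟨m, rfl⟩ := (hex x).1 hx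
        rw [LinearMap.mem_ker, LinearMap.comp_apply, hg', hex.apply_apply_eq_zero]
    exact ⟨σ, (hρ _ _).2 ⟨g, fun x => (hσ x).symm, hg'⟩⟩
  · intro hs g
    obtain ⟨μ, rfl⟩ := LinearMap.exists_comp_eq_of_range_le hi (g := g) fun m =>
      (hex _).1 <| h.mem_ker_of_smul_eq_zero fun a => by
        rw [mul_smul, ← map_smul, ← map_smul, heM, map_zero]
    obtain ⟨σ, hσ⟩ := hs μ
    obtain ⟨p, -, hp⟩ := (hρ _ _).1 hσ
    exact ⟨p, LinearMap.ext hp⟩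

variable {B : Type u} [Ring B] {f : A →+* B} [Module A B] [IsArtinianRing A] [Module B M]
  (hf : Function.Surjective f) (hker : ∀ a, f a = 0 ↔ a ∈ TwoSidedIdeal.span {e})
  (hB : ∀ a (b : B), a • b = f a • b) (hM : ∀ (a : A) (m : M), a • m = f a • m)

include hf hker hB hM

omit [Module.Injective A S] [IsArtinianRing A] in
lemma extZero_one_quotient_iff : extZero A S B 1 ↔ ∀ g : M →ₗ[B] B, g = 0 := by
  have hPS := h.isProjCover.1
  have heB : ∀ b : B, e • b = 0 := fun b => by
    rw [hB, (hker e).2 (TwoSidedIdeal.subset_span rfl), zero_smul]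
  rw [extZero_one_iff hi hex h.isProjCover.2.2.1]
  constructor
  · intro hs g
    obtain ⟨g', hg'⟩ := hs (linearMapRestrict f hM hB g)
    rw [h.hom_eq_zero_of_smul heB g', LinearMap.zero_comp] at hg'
    ext m
    exact (LinearMap.congr_fun hg' m).symm
  · refine fun hs g => ⟨0, ?_⟩
    have := hs (linearMapOfSurjective f hf hM hB g)
    ext m
    exact (LinearMap.congr_fun this m).symm

lemma extZero_add_two_quotient_iff (n : ℕ) :
    extZero A S B (n + 2) ↔ extZero B M B (n + 1) := by
  have hPS := h.isProjCover.1
  have := h.projective_quotient hf hker hB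
  rw [extZero_add_two_iff hi hex h.isProjCover.2.2.1]
  exact extZero_iff_of_surjective f hf hB hB LinearMap.id Function.injective_id
    (fun y _ => ⟨y, rfl⟩) n M hM

lemma extZero_add_two_cover_iff (n : ℕ) :
    extZero A S PS (n + 2) ↔ extZero B M M (n + 1) := by
  have hPS := h.isProjCover.1
  have := h.projective_quotient hf hker hB
  rw [extZero_add_two_iff hi hex h.isProjCover.2.2.1]
  refine extZero_iff_of_surjective f hf hB hM i hi (fun y hy => (hex y).1 ?_) n M hM
  refine h.mem_ker_of_smul_eq_zero fun a => hy _ ?_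
  rw [map_mul, (hker e).2 (TwoSidedIdeal.subset_span rfl), zero_mul]

lemma sGp_iff (k : Type u) [CommRing k] [IsArtinianRing k] [Algebra k A] [Module.Finite k A] :
    sGp A S ↔ NunkeL B M ∧ (∀ j : ℕ, 1 ≤ j → extZero B M M j) ∧
      (Subsingleton M ∨ ∃ φ : Module.End A M ≃+* Module.End A S,
        ∀ c : k, φ (centralSMul k A c M) = centralSMul k A c S) := by
  have heM : ∀ m : M, e • m = 0 := fun m => by
    rw [hM, (hker e).2 (TwoSidedIdeal.subset_span rfl), zero_smul]
  have hpos : ∀ {P : ℕ → Prop}, (∀ j, 1 ≤ j → P j) ↔ ∀ n, P (n + 1) :=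
    ⟨fun H n => H _ n.succ_pos, fun H j hj => Nat.sub_add_cancel hj ▸ H (j - 1)⟩
  have hsucc : ∀ {P : ℕ → Prop}, (∀ n, P n) ↔ P 0 ∧ ∀ n, P (n + 1) :=
    ⟨fun H => ⟨H 0, fun n => H _⟩, fun H n => n.casesOn H.1 H.2⟩
  rw [← h.extZero_one_cover_iff hi hex heM k, NunkeL, sGp, sGp, hpos, hpos, hpos]
  simp only [h.extZero_succ_self_iff hf hker hB, forall_and,
    ← h.extZero_add_two_quotient_iff hi hex hf hker hB hM,
    ← h.extZero_add_two_cover_iff hi hex hf hker hB hM]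
  rw [hsucc (P := fun n => extZero A S PS (n + 1)), hsucc (P := fun n => extZero A S B (n + 1)),
    zero_add, h.extZero_one_quotient_iff hi hex hf hker hB hM]
  tauto

end IsPointedCover

end Syzygy

/-- Proposition 3.6: `S` is semi-Gorenstein-projective iff `M = Ω S` is a Nunke `B`-module
with `Ext^i_B(M, M) = 0` for all `i ≥ 1` and either `M = 0` or `End(M) ≅ D = End(S)` as a
`k`-algebra. -/
theorem simple_injective_sgp_iff (k : Type u) [CommRing k] [IsArtinianRing k]
    (A : Type u) [Ring A] [Algebra k A] [Module.Finite k A]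
    (e₀ : A) (he₀ : IsPrimIdem A e₀)
    (S : Type u) [AddCommGroup S] [Module A S] [Module.Finite A S]
    (hsimple : IsSimpleModule A S) (hinjective : Module.Injective A S)
    (heS : ∃ s : S, e₀ • s ≠ 0)
    (PS : Type u) [AddCommGroup PS] [Module A PS]
    (eP : PS →ₗ[A] S) (hcov : IsProjCover A eP)
    (M' : ModuleCat.{u} (Bquot A e₀))
    (hM' : Nonempty ((↥((ModuleCat.restrictScalars (Bproj A e₀)).obj M')) ≃ₗ[A]
      ↥(radM A PS))) :
    sGp A S ↔
      (NunkeL (Bquot A e₀) (↥M') ∧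
        (∀ i : ℕ, 1 ≤ i → extZero (Bquot A e₀) (↥M') (↥M') i) ∧
        (Subsingleton (↥M') ∨
          ∃ φ : (Module.End A (↥((ModuleCat.restrictScalars (Bproj A e₀)).obj M'))) ≃+*
              (Module.End A S),
            ∀ c : k, φ (centralSMul k A c
                (↥((ModuleCat.restrictScalars (Bproj A e₀)).obj M'))) =
              centralSMul k A c S)) := by
  obtain ⟨q, h⟩ := hcov.exists_isPointedCover he₀ heS
  have : IsArtinianRing A := isArtinian_of_tower k inferInstance
  obtain ⟨ι⟩ := hM'
  let f := Bproj A e₀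
  let : Module A (Bquot A e₀) := Module.compHom _ f
  let : Module (Bquot A e₀) ((ModuleCat.restrictScalars f).obj M') :=
    inferInstanceAs (Module (Bquot A e₀) M')
  refine h.sGp_iff (M := (ModuleCat.restrictScalars f).obj M')
    (i := (radM A PS).subtype ∘ₗ ι.toLinearMap) (f := f)
    ((radM A PS).subtype_injective.comp ι.injective) (fun x => ?_) (RingCon.mk'_surjective _)
    (fun a => ?_) (fun _ _ => rfl) (fun _ _ => rfl) k
  · rw [← LinearMap.mem_ker, ← h.radM_eq_ker]
    exact ⟨fun hx => ⟨ι.symm ⟨x, hx⟩, by simp⟩, by rintro ⟨m, rfl⟩; exact (ι m).2⟩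
  · rw [← TwoSidedIdeal.mem_ker, TwoSidedIdeal.ker_ringCon_mk']
end

section
/- There exists an artin algebra A possessing a simple injective Nunke module if and only if there exists an artin algebra B possessing an indecomposable semi-Gorenstein-projective module M with rad End(M) = 0, such that Hom_B(M, B) = 0 and Ext^i_B(M, M) = 0 for all i ≥ 1. -/
/-!
Common background: `A` is an artin algebra (an algebra over a commutative artinian
ring `k`, finitely generated as `k`-module).  Left `A`-modules are `Module A M`;
right `A`-modules are `Module Aᵐᵒᵖ N`.  `Dl A M = Hom_A(M,A)` is the `A`-dual of a
left module (a right module) and `Dr A N` the dual of a right module (a left module);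
`evalL A M : M → M**` is the canonical evaluation map `φ_M`.
-/

open CategoryTheory LinearMap

universe u

/-- A module is indecomposable: it is nonzero and admits no nontrivial direct
decomposition. -/
def Indec (R : Type u) [Ring R] (M : Type u) [AddCommGroup M] [Module R M] : Prop :=
  Nontrivial M ∧ ∀ N N' : Submodule R M, IsCompl N N' → N = ⊥ ∨ N' = ⊥

/-- An artin algebra `A` together with a simple injective Nunke `A`-module `S`. -/
structure SimpleInjectiveNunkeData : Type (u+1) where
  k : Type u
  [ck : CommRing k]
  [ak : IsArtinianRing k]
  A : Type u
  [rA : Ring A]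
  [alg : Algebra k A]
  [finA : Module.Finite k A]
  S : Type u
  [acgS : AddCommGroup S]
  [modS : Module A S]
  [finS : Module.Finite A S]
  simple : IsSimpleModule A S
  injective : Module.Injective A S
  nunke : NunkeL A S

/-- An artin algebra `B` with an indecomposable semi-Gorenstein-projective module `M` with
`rad End(M) = 0`, `Hom(M, B) = 0` and `Ext^i_B(M, M) = 0` for all `i ≥ 1`. -/
structure SpecialSgpModuleData : Type (u+1) where
  k : Type u
  [ck : CommRing k]
  [ak : IsArtinianRing k]
  B : Type u
  [rB : Ring B]
  [alg : Algebra k B]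
  [finB : Module.Finite k B]
  M : Type u
  [acgM : AddCommGroup M]
  [modM : Module B M]
  [finM : Module.Finite B M]
  indec : Indec B M
  sgp : sGp B M
  radEnd : Ideal.jacobson (⊥ : Ideal (Module.End B M)) = ⊥
  hom_zero : ∀ g : M →ₗ[B] B, g = 0
  ext_self : ∀ i : ℕ, 1 ≤ i → extZero B M M i

section Ext

open Abelian

variable {R : Type u} [Ring R]

/-- Vanishing of `Ext` in positive degree, computed from a projective resolution. -/
lemma extZero_succ_iff {X Y : ModuleCat.{u} R} (P : ProjectiveResolution X) (n : ℕ) :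
    extZero R X Y (n + 1) ↔ ∀ f : P.complex.X (n + 1) ⟶ Y,
      P.complex.d (n + 2) (n + 1) ≫ f = 0 →
        ∃ g : P.complex.X n ⟶ Y, P.complex.d (n + 1) n ≫ g = f := by
  refine (P.isoExt (R := ℤ) (n + 1) Y).isZero_iff.trans ?_
  rw [← HomologicalComplex.exactAt_iff_isZero_homology,
    HomologicalComplex.exactAt_iff' _ n (n + 1) (n + 2) (by simp) (by simp),
    ShortComplex.moduleCat_exact_iff]
  rfl

lemma subsingleton_ext_succ_iff {X Y : ModuleCat.{u} R} (P : ProjectiveResolution X) (n : ℕ) :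
    Subsingleton (Abelian.Ext X Y (n + 1)) ↔ ∀ f : P.complex.X (n + 1) ⟶ Y,
      P.complex.d (n + 2) (n + 1) ≫ f = 0 →
        ∃ g : P.complex.X n ⟶ Y, P.complex.d (n + 1) n ≫ g = f := by
  constructor
  · intro h f hf
    exact (P.extMk_eq_zero_iff f (n + 2) rfl hf n rfl).1 (Subsingleton.elim _ _)
  · intro h
    refine subsingleton_of_forall_eq 0 fun α => ?_
    obtain ⟨f, hf, rfl⟩ := P.extMk_surjective α (n + 2) rfl
    exact (P.extMk_eq_zero_iff f (n + 2) rfl hf n rfl).2 (h f hf)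

lemma extZero_iff_subsingleton {M N : Type u} [AddCommGroup M] [Module R M]
    [AddCommGroup N] [Module R N] (n : ℕ) :
    extZero R M N (n + 1) ↔
      Subsingleton (Abelian.Ext (ModuleCat.of R M) (ModuleCat.of R N) (n + 1)) :=
  let P := projectiveResolution (ModuleCat.of R M)
  (extZero_succ_iff (Y := ModuleCat.of R N) P n).trans (subsingleton_ext_succ_iff P n).symm

lemma shortExact_ofHom {X Y Z : Type u} [AddCommGroup X] [Module R X] [AddCommGroup Y] [Module R Y]
    [AddCommGroup Z] [Module R Z] {f : X →ₗ[R] Y} {g : Y →ₗ[R] Z} (hf : Function.Injective f)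
    (hfg : Function.Exact f g) (hg : Function.Surjective g) :
    (ShortComplex.mk (ModuleCat.ofHom f) (ModuleCat.ofHom g)
      (by rw [← ModuleCat.ofHom_comp, hfg.linearMap_comp_eq_zero]; rfl)).ShortExact where
  exact := (ShortComplex.ShortExact.moduleCat_exact_iff_function_exact _).2 hfg
  mono_f := (ModuleCat.mono_iff_injective _).2 hf
  epi_g := (ModuleCat.epi_iff_surjective _).2 hg

section LongExact

variable {X Y Z N : Type u} [AddCommGroup X] [Module R X] [AddCommGroup Y] [Module R Y]
  [AddCommGroup Z] [Module R Z] [AddCommGroup N] [Module R N] {f : X →ₗ[R] Y} {g : Y →ₗ[R] Z}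

lemma extZero_succ_of_exact_left (hf : Function.Injective f) (hfg : Function.Exact f g)
    (hg : Function.Surjective g) {n : ℕ} (hX : extZero R X N (n + 1))
    (hZ : extZero R Z N (n + 1)) : extZero R Y N (n + 1) := by
  rw [extZero_iff_subsingleton] at hX hZ ⊢
  refine subsingleton_of_forall_eq 0 fun α => ?_
  obtain ⟨β, rfl⟩ := Ext.contravariant_sequence_exact₂ (shortExact_ofHom hf hfg hg) _ α
    (hX.elim _ _)
  rw [hZ.elim β 0, Ext.comp_zero]

lemma extZero_succ_of_exact_right (hf : Function.Injective f) (hfg : Function.Exact f g)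
    (hg : Function.Surjective g) {n : ℕ} (hX : extZero R N X (n + 1))
    (hZ : extZero R N Z (n + 1)) : extZero R N Y (n + 1) := by
  rw [extZero_iff_subsingleton] at hX hZ ⊢
  refine subsingleton_of_forall_eq 0 fun α => ?_
  obtain ⟨β, rfl⟩ := Ext.covariant_sequence_exact₂ _ (shortExact_ofHom hf hfg hg) α
    (hZ.elim _ _)
  rw [hX.elim β 0, Ext.zero_comp]

lemma extZero_succ_of_projective [Module.Projective R X] (n : ℕ) : extZero R X N (n + 1) :=
  isZero_Ext_succ_of_projective _ _ n

lemma extZero_succ_of_injective (h : Module.Injective R N) (n : ℕ) : extZero R X N (n + 1) := by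
  have : Injective (ModuleCat.of R N) := Module.injective_object_of_injective_module R N
  exact (extZero_iff_subsingleton n).2 (Ext.subsingleton_of_injective _ _ n)

/-- Dimension shifting along a short exact sequence with projective middle term. -/
lemma extZero_add_two_of_exact [Module.Projective R Y] (hf : Function.Injective f)
    (hfg : Function.Exact f g) (hg : Function.Surjective g) {n : ℕ}
    (hX : extZero R X N (n + 1)) : extZero R Z N (n + 2) := by
  rw [extZero_iff_subsingleton] at hX ⊢
  refine subsingleton_of_forall_eq 0 fun α => ?_
  obtain ⟨β, rfl⟩ := Ext.contravariant_sequence_exact₃ (shortExact_ofHom hf hfg hg) _ α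
    (Ext.eq_zero_of_projective _) (n₀ := n + 1) (by omega)
  rw [hX.elim β 0, Ext.comp_zero]

lemma extZero_one_of_exact [Module.Projective R Y] (hf : Function.Injective f)
    (hfg : Function.Exact f g) (hg : Function.Surjective g)
    (h : ∀ φ : X →ₗ[R] N, ∃ ψ : Y →ₗ[R] N, ψ.comp f = φ) : extZero R Z N 1 := by
  rw [extZero_iff_subsingleton]
  refine subsingleton_of_forall_eq 0 fun α => ?_
  obtain ⟨β, rfl⟩ := Ext.contravariant_sequence_exact₃ (shortExact_ofHom hf hfg hg) _ α
    (Ext.eq_zero_of_projective _) (n₀ := 0) rfl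
  obtain ⟨φ, rfl⟩ := (Ext.mk₀_bijective _ _).2 β
  obtain ⟨ψ, hψ⟩ := h φ.hom
  obtain rfl : ModuleCat.ofHom f ≫ ModuleCat.ofHom ψ = φ := ModuleCat.hom_ext hψ
  rw [← Ext.mk₀_comp_mk₀]
  exact (shortExact_ofHom hf hfg hg).extClass_comp_assoc _

end LongExact

end Ext

section ChangeOfRings

variable {A B : Type u} [Ring A] [Ring B] (π : A →+* B)

/-- If `π : A →+* B` has an `A`-linear section, then projective `B`-modules are projective as
`A`-modules. -/
lemma projective_restrictScalars {P : Type u} [AddCommGroup P] [Module B P] [Module A P]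
    (hP : ∀ (a : A) (x : P), a • x = π a • x) (σ : B →+ A) (hσ : ∀ b, π (σ b) = b)
    (hσm : ∀ a b, σ (π a * b) = a * σ b) [h : Module.Projective B P] : Module.Projective A P := by
  obtain ⟨s, hs⟩ := h.out
  refine ⟨⟨⟨⟨fun x => (s x).mapRange σ σ.map_zero, fun x y => ?_⟩, fun a x => ?_⟩, fun x => ?_⟩⟩
  · rw [map_add, Finsupp.mapRange_add σ.map_add]
  · ext y
    simp [hP, hσm]
  · have := hs x
    rw [Finsupp.linearCombination_apply] at this ⊢
    refine Eq.trans ?_ this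
    refine (Finsupp.sum_mapRange_index (hf := σ.map_zero) (by simp)).trans ?_
    simp [hP, hσ]

lemma preservesHomology_restrictScalars : (ModuleCat.restrictScalars.{u} π).PreservesHomology :=
  ((Functor.exact_tfae (ModuleCat.restrictScalars.{u} π)).out 1 2).1 fun S hS => by
    rw [ShortComplex.ShortExact.moduleCat_exact_iff_function_exact] at hS ⊢
    exact hS

lemma exists_restrictScalars_map_eq (hπ : Function.Surjective π) {X Y : ModuleCat.{u} B}
    (φ : (ModuleCat.restrictScalars.{u} π).obj X ⟶ (ModuleCat.restrictScalars.{u} π).obj Y) :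
    ∃ ψ : X ⟶ Y, (ModuleCat.restrictScalars.{u} π).map ψ = φ := by
  refine ⟨ModuleCat.ofHom ⟨⟨fun x => φ.hom x, fun x y => φ.hom.map_add x y⟩, fun b x => ?_⟩, rfl⟩
  obtain ⟨a, rfl⟩ := hπ b
  exact φ.hom.map_smul a x

/-- Vanishing of `Ext` passes from `B` to `A` along a surjection `π : A →+* B` which has an
`A`-linear section. -/
lemma extZero_restrictScalars (hπ : Function.Surjective π) (σ : B →+ A) (hσ : ∀ b, π (σ b) = b)
    (hσm : ∀ a b, σ (π a * b) = a * σ b) {M N : Type u} [AddCommGroup M] [Module B M]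
    [AddCommGroup N] [Module B N] {n : ℕ} (h : extZero B M N (n + 1)) :
    extZero A ((ModuleCat.restrictScalars π).obj (ModuleCat.of B M))
      ((ModuleCat.restrictScalars π).obj (ModuleCat.of B N)) (n + 1) := by
  have : (ModuleCat.restrictScalars.{u} π).PreservesHomology := preservesHomology_restrictScalars π
  have : (ModuleCat.restrictScalars.{u} π).PreservesProjectiveObjects := ⟨fun {P} hP => by
    have : Module.Projective B P := (IsProjective.iff_projective P).2 hP
    let : Module A P := Module.compHom P π
    have : Module.Projective A P := projective_restrictScalars π (fun _ _ => rfl) σ hσ hσm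
    exact (IsProjective.iff_projective (R := A) P).1 this⟩
  let P := projectiveResolution (ModuleCat.of B M)
  refine (extZero_succ_iff ((ModuleCat.restrictScalars.{u} π).mapProjectiveResolution P) n).2
    fun f hf => ?_
  obtain ⟨f, rfl⟩ := exists_restrictScalars_map_eq π hπ f
  have hf' : P.complex.d (n + 2) (n + 1) ≫ f = 0 := (ModuleCat.restrictScalars.{u} π).map_injective
    (((ModuleCat.restrictScalars.{u} π).map_comp _ _).trans
      (hf.trans ((ModuleCat.restrictScalars.{u} π).map_zero _ _).symm))
  obtain ⟨g, hg⟩ := (extZero_succ_iff (Y := ModuleCat.of B N) P n).1 h f hf'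
  refine ⟨(ModuleCat.restrictScalars.{u} π).map g, ?_⟩
  have h1 := congrArg (ModuleCat.restrictScalars.{u} π).map hg
  rw [Functor.map_comp] at h1
  exact h1

end ChangeOfRings

section OnePointExtension

/-- The one-point extension of `B` by a left `B`-module `M`, that is the triangular matrix ring with
diagonal entries `B` and `End_B(M)ᵒᵖ` and off-diagonal entry `M`, a triple `(b, m, d)` standing for
the matrix with rows `(b, m)` and `(0, d)`. -/
def OnePointExt (B M : Type u) [Ring B] [AddCommGroup M] [Module B M] : Type u :=
  B × M × Module.End B M

namespace OnePointExt

variable {B M : Type u} [Ring B] [AddCommGroup M] [Module B M]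

instance : AddCommGroup (OnePointExt B M) :=
  inferInstanceAs (AddCommGroup (B × M × Module.End B M))

/-- The entry in `B`. -/
def base (x : OnePointExt B M) : B := x.1

/-- The off-diagonal entry. -/
def off (x : OnePointExt B M) : M := x.2.1

/-- The entry in the endomorphism ring. -/
def corner (x : OnePointExt B M) : Module.End B M := x.2.2

/-- The matrix with the given entries. -/
def mk (b : B) (m : M) (d : Module.End B M) : OnePointExt B M := (b, m, d)

@[ext]
lemma ext {x y : OnePointExt B M} (h₁ : x.base = y.base) (h₂ : x.off = y.off)
    (h₃ : x.corner = y.corner) : x = y :=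
  Prod.ext h₁ (Prod.ext h₂ h₃)

instance : Mul (OnePointExt B M) :=
  ⟨fun x y => mk (x.base * y.base) (x.base • y.off + y.corner x.off) (y.corner * x.corner)⟩

instance : One (OnePointExt B M) := ⟨mk 1 0 1⟩

section Entries

variable (x y : OnePointExt B M) (b : B) (m : M) (d : Module.End B M)

@[simp] lemma base_mk : (mk b m d).base = b := rfl
@[simp] lemma off_mk : (mk b m d).off = m := rfl
@[simp] lemma corner_mk : (mk b m d).corner = d := rfl
@[simp] lemma base_zero : (0 : OnePointExt B M).base = 0 := rfl
@[simp] lemma off_zero : (0 : OnePointExt B M).off = 0 := rfl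
@[simp] lemma corner_zero : (0 : OnePointExt B M).corner = 0 := rfl
@[simp] lemma base_add : (x + y).base = x.base + y.base := rfl
@[simp] lemma off_add : (x + y).off = x.off + y.off := rfl
@[simp] lemma corner_add : (x + y).corner = x.corner + y.corner := rfl
@[simp] lemma base_one : (1 : OnePointExt B M).base = 1 := rfl
@[simp] lemma off_one : (1 : OnePointExt B M).off = 0 := rfl
@[simp] lemma corner_one : (1 : OnePointExt B M).corner = 1 := rfl
@[simp] lemma base_mul : (x * y).base = x.base * y.base := rfl
@[simp] lemma off_mul : (x * y).off = x.base • y.off + y.corner x.off := rfl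
@[simp] lemma corner_mul : (x * y).corner = y.corner * x.corner := rfl

end Entries

instance : Ring (OnePointExt B M) where
  toAddCommGroup := inferInstance
  mul_assoc x y z := by ext <;> simp [mul_assoc, mul_smul, add_assoc]
  one_mul x := by ext <;> simp
  mul_one x := by ext <;> simp
  left_distrib x y z := by ext <;> simp [mul_add, add_mul]; abel
  right_distrib x y z := by ext <;> simp [mul_add, add_mul, add_smul]; abel
  zero_mul x := by ext <;> simp
  mul_zero x := by ext <;> simp

section Algebra

variable {k : Type u} [CommRing k] [Algebra k B] [Module k M] [IsScalarTower k B M]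

instance : Module k (OnePointExt B M) :=
  inferInstanceAs (Module k (B × M × Module.End B M))

@[simp] lemma base_smul (r : k) (x : OnePointExt B M) : (r • x).base = r • x.base := rfl
@[simp] lemma off_smul (r : k) (x : OnePointExt B M) : (r • x).off = r • x.off := rfl
@[simp] lemma corner_smul (r : k) (x : OnePointExt B M) : (r • x).corner = r • x.corner := rfl

instance : Algebra k (OnePointExt B M) :=
  Algebra.ofModule
    (fun r x y => by ext <;> simp [LinearMap.map_smul_of_tower])
    (fun r x y => by ext <;> simp [smul_comm x.base r])

lemma finite [IsArtinianRing k] [Module.Finite k B] [Module.Finite B M] :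
    Module.Finite k (OnePointExt B M) := by
  have : Module.Finite k M := Module.Finite.trans B M
  have : Module.Finite k (Module.End B M) :=
    Module.Finite.of_injective (LinearMap.restrictScalarsₗ k B M M k)
      (LinearMap.restrictScalars_injective k)
  exact inferInstanceAs (Module.Finite k (B × M × Module.End B M))

end Algebra

variable (B M) in
/-- The simple module at the extension vertex. -/
def Top : Type u := Module.End B M

instance : AddCommGroup (Top B M) := inferInstanceAs (AddCommGroup (Module.End B M))

instance : Module (OnePointExt B M) (Top B M) where
  smul x s := Mul.mul (α := Module.End B M) s x.corner
  one_smul s := mul_one (M := Module.End B M) s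
  mul_smul x y s := (mul_assoc (G := Module.End B M) s y.corner x.corner).symm
  smul_zero x := zero_mul (M₀ := Module.End B M) x.corner
  smul_add x s t := add_mul (R := Module.End B M) s t x.corner
  add_smul x y s := mul_add (R := Module.End B M) s x.corner y.corner
  zero_smul s := mul_zero (M₀ := Module.End B M) s

variable (B M) in
/-- The projection onto the upper left corner. -/
def baseHom : OnePointExt B M →+* B where
  toFun := base
  map_one' := rfl
  map_mul' _ _ := rfl
  map_zero' := rfl
  map_add' _ _ := rfl

variable (B M) in
/-- The projection of the regular module onto `Top B M`. -/
def toTop : OnePointExt B M →ₗ[OnePointExt B M] Top B M where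
  toFun x := x.corner
  map_add' _ _ := rfl
  map_smul' _ _ := rfl

variable (B M) in
/-- The `B`-module `B × M` as a module over the one-point extension. -/
noncomputable abbrev Row : ModuleCat.{u} (OnePointExt B M) :=
  (ModuleCat.restrictScalars (baseHom B M)).obj (ModuleCat.of B (B × M))

variable (B M) in
/-- The inclusion of the first row in the regular module. -/
noncomputable def ofRow : Row B M →ₗ[OnePointExt B M] OnePointExt B M where
  toFun x := mk x.1 x.2 0
  map_add' x y := by ext <;> simp <;> rfl
  map_smul' a x := by ext <;> simp <;> rfl

lemma ofRow_injective : Function.Injective (ofRow B M) := fun _ _ h =>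
  Prod.ext congr(($h).base) congr(($h).off)

lemma exact_ofRow_toTop : Function.Exact (ofRow B M) (toTop B M) := fun x =>
  ⟨fun h => ⟨(x.base, x.off), ext rfl rfl (Eq.symm h)⟩, by rintro ⟨y, rfl⟩; rfl⟩

lemma toTop_surjective : Function.Surjective (toTop B M) := fun d => ⟨mk 0 0 d, rfl⟩

variable (B M) in
/-- The identity of `M`, as a generator of `Top B M`. -/
def Top.gen : Top B M := (1 : Module.End B M)

lemma Top.smul_gen (x : OnePointExt B M) : x • Top.gen B M = (x.corner : Module.End B M) :=
  one_mul (M := Module.End B M) x.corner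

lemma finite_top : Module.Finite (OnePointExt B M) (Top B M) :=
  Module.Finite.of_surjective (toTop B M) toTop_surjective

lemma dual_top_eq_zero (f : Top B M →ₗ[OnePointExt B M] OnePointExt B M) : f = 0 := by
  have hgen : f (Top.gen B M) = 0 := by
    have key (x : OnePointExt B M) (hx : x.corner = 0) : x * f (Top.gen B M) = 0 := by
      rw [← smul_eq_mul, ← f.map_smul, Top.smul_gen, hx]
      exact f.map_zero
    have h₁ := key (mk 1 0 0) rfl
    have h₂ (m : M) := key (mk 0 m 0) rfl
    refine ext ?_ ?_ (LinearMap.ext fun m => ?_)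
    · simpa using congr(($h₁).base)
    · simpa using congr(($h₁).off)
    · simpa using congr(($(h₂ m)).off)
  refine LinearMap.ext fun s => ?_
  have hs : s = (mk 0 0 s : OnePointExt B M) • Top.gen B M :=
    (one_mul (M := Module.End B M) s).symm
  rw [hs, map_smul, hgen, smul_zero, LinearMap.zero_apply]

section Division

variable (hM : ∀ d : Module.End B M, d ≠ 0 → IsUnit d)

include hM

lemma isSimpleModule_top [Nontrivial M] : IsSimpleModule (OnePointExt B M) (Top B M) := by
  have : Nontrivial (Top B M) := inferInstanceAs (Nontrivial (Module.End B M))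
  refine isSimpleModule_iff_toSpanSingleton_surjective.2 ⟨this, fun s hs t => ?_⟩
  obtain ⟨v, hv⟩ := (hM s hs).exists_right_inv
  refine ⟨mk 0 0 (v * (show Module.End B M from t)), ?_⟩
  exact (mul_assoc _ _ _).symm.trans ((congrArg (· * _) hv).trans (one_mul _))

lemma injective_top : Module.Injective (OnePointExt B M) (Top B M) := by
  refine Module.Baer.injective fun I g => ?_
  have hI {x : OnePointExt B M} (hx : x ∈ I) : mk 0 0 x.corner ∈ I := by
    have := I.mul_mem_left (mk 0 0 1) hx
    convert this using 1
    ext <;> simp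
  have hg {x : OnePointExt B M} (hx : x ∈ I) : g ⟨x, hx⟩ = g ⟨_, hI hx⟩ := by
    have h₁ : (⟨_, hI hx⟩ : I) = (mk 0 0 1 : OnePointExt B M) • ⟨x, hx⟩ :=
      Subtype.ext (by ext <;> simp)
    rw [h₁, map_smul]
    exact (mul_one (M := Module.End B M) _).symm
  by_cases h : ∃ x ∈ I, x.corner ≠ 0
  · obtain ⟨x, hx, hx0⟩ := h
    obtain ⟨v, hv⟩ := (hM _ hx0).exists_right_inv
    have he : (mk 0 0 1 : OnePointExt B M) ∈ I := by
      have := I.mul_mem_left (mk 0 0 v) hx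
      have := hI this
      simpa [hv] using this
    refine ⟨LinearMap.toSpanSingleton _ _ (g ⟨_, he⟩), fun y hy => ?_⟩
    rw [hg hy, LinearMap.toSpanSingleton_apply]
    have h₁ : (⟨_, hI hy⟩ : I) = (mk 0 0 y.corner : OnePointExt B M) • ⟨_, he⟩ :=
      Subtype.ext (by ext <;> simp)
    rw [h₁, map_smul]
    rfl
  · push Not at h
    refine ⟨0, fun y hy => ?_⟩
    have h₁ : (⟨_, hI hy⟩ : I) = 0 := Subtype.ext (by ext <;> simp [h y hy])
    rw [hg hy, h₁, map_zero, LinearMap.zero_apply]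

end Division

lemma exists_comp_ofRow_eq (hB : ∀ f : M →ₗ[B] B, f = 0)
    (φ : Row B M →ₗ[OnePointExt B M] OnePointExt B M) :
    ∃ ψ : OnePointExt B M →ₗ[OnePointExt B M] OnePointExt B M, ψ.comp (ofRow B M) = φ := by
  have smul_def (a : OnePointExt B M) (x : B × M) : φ (a.base • x : B × M) = a * φ x :=
    φ.map_smul a x
  have add_def (x y : B × M) : φ (x + y : B × M) = φ x + φ y := φ.map_add x y
  have corner_eq (x : B × M) : (φ x).corner = 0 := by
    have := smul_def (mk 1 0 0) x
    rw [base_mk, one_smul] at this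
    rw [this]
    simp
  let f : M →ₗ[B] B :=
    { toFun m := (φ ((0, m) : B × M)).base
      map_add' m m' := by
        rw [← base_add, ← add_def]
        simp
      map_smul' b m := by
        have := smul_def (mk b 0 0) (0, m)
        simpa using congr(($this).base) }
  let d : Module.End B M :=
    { toFun m := (φ ((0, m) : B × M)).off
      map_add' m m' := by
        rw [← off_add, ← add_def]
        simp
      map_smul' b m := by
        have := smul_def (mk b 0 0) (0, m)
        simpa using congr(($this).off) }
  have hf (m : M) : (φ ((0, m) : B × M)).base = 0 := congr($(hB f) m)
  let c : OnePointExt B M := φ ((1, 0) : B × M)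
  refine ⟨LinearMap.toSpanSingleton _ _ (mk c.base c.off d), LinearMap.ext fun x => ?_⟩
  obtain ⟨b, m⟩ : B × M := x
  have hx : φ ((b, m) : B × M) = mk b 0 0 * c + φ ((0, m) : B × M) := by
    rw [← smul_def, ← add_def]
    simp
  change mk b m 0 * mk c.base c.off d = φ ((b, m) : B × M)
  rw [hx]
  refine ext ?_ ?_ ?_
  · simp [hf]
  · simp [d]
  · simp [corner_eq]

lemma extZero_row {n : ℕ} (h : extZero B (B × M) (B × M) (n + 1)) :
    extZero (OnePointExt B M) (Row B M) (Row B M) (n + 1) :=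
  extZero_restrictScalars (baseHom B M) (fun b => ⟨mk b 0 0, rfl⟩)
    { toFun b := mk b 0 0, map_zero' := rfl, map_add' _ _ := by ext <;> simp }
    (fun _ => rfl)
    (fun a b => show mk (a.base * b) 0 0 = a * mk b 0 0 by ext <;> simp) h

lemma sGp_top (hM : ∀ d : Module.End B M, d ≠ 0 → IsUnit d) (hB : ∀ f : M →ₗ[B] B, f = 0)
    (hMB : sGp B M) (hMM : ∀ i, 1 ≤ i → extZero B M M i) : sGp (OnePointExt B M) (Top B M) := by
  intro i hi
  obtain _ | _ | n := i
  · omega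
  · exact extZero_one_of_exact ofRow_injective exact_ofRow_toTop toTop_surjective
      (exists_comp_ofRow_eq hB)
  · refine extZero_add_two_of_exact ofRow_injective exact_ofRow_toTop toTop_surjective
      (extZero_succ_of_exact_right ofRow_injective exact_ofRow_toTop toTop_surjective
        (extZero_row ?_) (extZero_succ_of_injective (injective_top hM) n))
    have inl_injective : Function.Injective (LinearMap.inl B B M) := LinearMap.inl_injective
    have inl_snd : Function.Exact (LinearMap.inl B B M) (LinearMap.snd B B M) :=
      Function.Exact.inl_snd
    have snd_surjective : Function.Surjective (LinearMap.snd B B M) := LinearMap.snd_surjective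
    exact extZero_succ_of_exact_left inl_injective inl_snd snd_surjective
      (extZero_succ_of_projective n)
      (extZero_succ_of_exact_right inl_injective inl_snd snd_surjective
        (hMB _ (by omega)) (hMM _ (by omega)))

end OnePointExt

end OnePointExtension

section Endomorphisms

variable {R M : Type u} [Ring R] [AddCommGroup M] [Module R M]

lemma Indec.isUnit_or_isNilpotent [IsNoetherian R M] [IsArtinian R M] (h : Indec R M)
    (f : Module.End R M) : IsUnit f ∨ IsNilpotent f := by
  obtain ⟨n, hn⟩ := Filter.eventually_atTop.1
    (f.eventually_isCompl_ker_pow_range_pow.and (Filter.eventually_ge_atTop 1))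
  obtain ⟨hc, h1⟩ := hn n le_rfl
  rcases h.2 _ _ hc with hk | hr
  · left
    have hinj : Function.Injective (f ^ n) := LinearMap.ker_eq_bot.1 hk
    have : IsUnit (f ^ n) :=
      (Module.End.isUnit_iff _).2 ⟨hinj, IsArtinian.surjective_of_injective_endomorphism _ hinj⟩
    exact (isUnit_pow_iff (by omega)).1 this
  · exact .inr ⟨n, LinearMap.range_eq_bot.1 hr⟩

lemma Indec.isUnit_of_jacobson_eq_bot [IsNoetherian R M] [IsArtinian R M] (h : Indec R M)
    (hJ : Ideal.jacobson (⊥ : Ideal (Module.End R M)) = ⊥) (d : Module.End R M) (hd : d ≠ 0) :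
    IsUnit d := by
  by_contra hu
  refine hd ((Submodule.mem_bot _).1 (hJ.le (Ideal.mem_jacobson_iff.2 fun y => ?_)))
  have hyd : ¬ IsUnit (y * d) := fun hyd => hu <| by
    have hinj : Function.Injective d := .of_comp ((Module.End.isUnit_iff _).1 hyd).1
    exact (Module.End.isUnit_iff _).2 ⟨hinj, IsArtinian.surjective_of_injective_endomorphism _ hinj⟩
  obtain ⟨z, hz⟩ :=
    ((h.isUnit_or_isNilpotent (y * d)).resolve_left hyd).isUnit_add_one.exists_left_inv
  exact ⟨z, by rw [Submodule.mem_bot, sub_eq_zero, ← hz, mul_add, mul_one, mul_assoc]⟩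

lemma indec_of_isSimpleModule [IsSimpleModule R M] : Indec R M := by
  refine ⟨IsSimpleModule.nontrivial R M, fun N N' h => (eq_bot_or_eq_top N).imp_right ?_⟩
  rintro rfl
  exact eq_bot_of_top_isCompl h

lemma jacobson_bot_end_of_isSimpleModule [IsSimpleModule R M] :
    Ideal.jacobson (⊥ : Ideal (Module.End R M)) = ⊥ := by
  classical
  exact Ideal.jacobson_eq_self_of_isMaximal (H := Ideal.bot_isMaximal)

end Endomorphisms

/-- Corollary 3.7: there exists an artin algebra with a simple injective Nunke module iff
there exists an artin algebra with an indecomposable semi-Gorenstein-projective module `M`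
with `rad End(M) = 0`, `Hom(M, B) = 0` and `Ext^i_B(M, M) = 0` for all `i ≥ 1`. -/
theorem exists_simple_injective_nunke_iff :
    Nonempty SimpleInjectiveNunkeData.{u} ↔ Nonempty SpecialSgpModuleData.{u} := by
  constructor
  · rintro ⟨⟨k, A, S, hS, hI, hN⟩⟩
    refine ⟨{
      k := k
      B := A
      M := S
      indec := indec_of_isSimpleModule
      sgp := hN.1
      radEnd := jacobson_bot_end_of_isSimpleModule
      hom_zero := hN.2
      ext_self := ?_ }⟩
    rintro (_ | i) hi
    · omega
    · exact extZero_succ_of_injective hI i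
  · rintro ⟨⟨k, B, M, hM, hs, hJ, h0, hE⟩⟩
    let : Module k M := Module.compHom M (algebraMap k B)
    have : IsScalarTower k B M := ⟨fun r b m => by rw [Algebra.smul_def, mul_smul]; rfl⟩
    have : IsArtinianRing B := IsArtinianRing.of_finite k B
    have : Nontrivial M := hM.1
    have hd := hM.isUnit_of_jacobson_eq_bot hJ
    exact ⟨{
      k := k
      A := OnePointExt B M
      S := OnePointExt.Top B M
      finA := OnePointExt.finite
      finS := OnePointExt.finite_top
      simple := OnePointExt.isSimpleModule_top hd
      injective := OnePointExt.injective_top hd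
      nunke := ⟨OnePointExt.sGp_top hd h0 hs hE, OnePointExt.dual_top_eq_zero⟩ }⟩
end

section
/- Let A be a local artin algebra and M a semi-Gorenstein-projective left A-module. If M* is projective, then M is projective. -/
/-!
Common background: `A` is an artin algebra (an algebra over a commutative artinian
ring `k`, finitely generated as `k`-module).  Left `A`-modules are `Module A M`;
right `A`-modules are `Module Aᵐᵒᵖ N`.  `Dl A M = Hom_A(M,A)` is the `A`-dual of a
left module (a right module) and `Dr A N` the dual of a right module (a left module);
`evalL A M : M → M**` is the canonical evaluation map `φ_M`.
-/

open CategoryTheory LinearMap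

universe u

section DualBasis

variable {A : Type u} [Ring A]

/-- A finitely generated projective right module admits a finite dual basis. -/
theorem exists_dual_basis (Q : Type u) [AddCommGroup Q] [Module Aᵐᵒᵖ Q] [Module.Finite Aᵐᵒᵖ Q]
    [Module.Projective Aᵐᵒᵖ Q] :
    ∃ (n : ℕ) (x : Fin n → Q) (f : Fin n → Dr A Q),
      ∀ q, q = ∑ j, MulOpposite.op (f j q) • x j := by
  obtain ⟨n, p, i, -, -, hpi⟩ := Module.Finite.exists_comp_eq_id_of_projective Aᵐᵒᵖ Q
  refine ⟨n, fun j => p (Pi.single j 1), fun j =>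
    { toFun := fun q => (i q j).unop
      map_add' := fun q r => by simp
      map_smul' := fun b q => by simp }, fun q => ?_⟩
  have h : p (i q) = q := LinearMap.congr_fun hpi q
  conv_lhs => rw [← h, pi_eq_sum_univ' (i q)]
  simp only [map_sum, map_smul]
  refine Finset.sum_congr rfl fun j _ => ?_
  simp only [LinearMap.coe_mk, AddHom.coe_mk, MulOpposite.op_unop]

variable {Q : Type u} [AddCommGroup Q] [Module Aᵐᵒᵖ Q] {n : ℕ} {x : Fin n → Q}
  {f : Fin n → Dr A Q}

theorem eq_sum_of_dual_basis (h : ∀ q, q = ∑ j, MulOpposite.op (f j q) • x j) (g : Dr A Q) :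
    g = ∑ j, g (x j) • f j := by
  ext q
  conv_lhs => rw [h q]
  simp

theorem finite_projective_dual (h : ∀ q, q = ∑ j, MulOpposite.op (f j q) • x j) :
    Module.Finite A (Dr A Q) ∧ Module.Projective A (Dr A Q) := by
  let i : Dr A Q →ₗ[A] (Fin n → A) :=
    { toFun := fun g j => g (x j)
      map_add' := fun g g' => rfl
      map_smul' := fun a g => rfl }
  have hi : (Fintype.linearCombination A f).comp i = LinearMap.id := by
    refine LinearMap.ext fun g => ?_
    simpa [Fintype.linearCombination_apply, i] using (eq_sum_of_dual_basis h g).symm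
  exact ⟨Module.Finite.of_surjective (Fintype.linearCombination A f)
    fun g => ⟨i g, LinearMap.congr_fun hi g⟩, Module.Projective.of_split i _ hi⟩

theorem evalR_surjective_of_dual_basis (h : ∀ q, q = ∑ j, MulOpposite.op (f j q) • x j) :
    Function.Surjective (evalR A Q) := by
  intro φ
  refine ⟨∑ j, MulOpposite.op (φ (f j)) • x j, LinearMap.ext fun g => ?_⟩
  conv_rhs => rw [eq_sum_of_dual_basis h g]
  simp [evalR]

end DualBasis

/-- In a local ring, all maximal left ideals coincide. -/
theorem eq_of_isMaximal_of_isLocalRing {A : Type u} [Ring A] [IsLocalRing A] {I J : Ideal A}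
    (hI : I.IsMaximal) (hJ : J.IsMaximal) : I = J := by
  by_contra hne
  have hsup : I ⊔ J = ⊤ := hI.coprime_of_ne hJ hne
  obtain ⟨a, ha, b, hb, hab⟩ := Submodule.mem_sup.1 (hsup ▸ Submodule.mem_top : (1 : A) ∈ I ⊔ J)
  rcases IsLocalRing.isUnit_or_isUnit_of_add_one hab with h | h
  · exact hI.ne_top (I.eq_top_of_isUnit_mem ha h)
  · exact hJ.ne_top (J.eq_top_of_isUnit_mem hb h)

/-- Over a local left artinian ring, a finitely generated module with zero dual is zero. -/
theorem subsingleton_of_dual_eq_zero {A : Type u} [Ring A] [IsLocalRing A] [IsArtinianRing A]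
    (C : Type u) [AddCommGroup C] [Module A C] [Module.Finite A C] (h : ∀ f : Dl A C, f = 0) :
    Subsingleton C := by
  by_contra hC
  rw [not_subsingleton_iff_nontrivial] at hC
  obtain ⟨N, hN, -⟩ := (eq_top_or_exists_le_coatom (⊥ : Submodule A C)).resolve_left bot_ne_top
  obtain ⟨I, hI, -⟩ := (eq_bot_or_exists_atom_le (⊤ : Submodule A A)).resolve_left top_ne_bot
  have hs : IsSimpleModule A (C ⧸ N) := isSimpleModule_iff_isCoatom.2 hN
  have ht : IsSimpleModule A I := isSimpleModule_iff_isAtom.2 hI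
  obtain ⟨m, hm, ⟨e⟩⟩ := isSimpleModule_iff_quot_maximal.1 hs
  obtain ⟨m', hm', ⟨e'⟩⟩ := isSimpleModule_iff_quot_maximal.1 ht
  obtain rfl := eq_of_isMaximal_of_isLocalRing hm hm'
  have h0 := h (I.subtype.comp ((e.trans e'.symm).toLinearMap.comp N.mkQ))
  refine hN.1 (eq_top_iff.2 fun c _ => ?_)
  have hc := LinearMap.congr_fun h0 c
  simpa using hc

/-- Over a right noetherian ring, the dual of a finitely generated left module is finitely
generated. -/
theorem finite_dual {A : Type u} [Ring A] [IsNoetherian Aᵐᵒᵖ A] (M : Type u) [AddCommGroup M]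
    [Module A M] [Module.Finite A M] : Module.Finite Aᵐᵒᵖ (Dl A M) := by
  obtain ⟨n, p, hp⟩ := Module.Finite.exists_fin' A M
  let r : Dl A M →ₗ[Aᵐᵒᵖ] (Fin n → A) :=
    { toFun := fun f j => f (p (Pi.single j 1))
      map_add' := fun f g => rfl
      map_smul' := fun a f => rfl }
  have hr : Function.Injective r := by
    intro f g hfg
    have hc : f.comp p = g.comp p := by
      ext j
      simpa [r] using congr_fun hfg j
    exact LinearMap.ext fun m => by
      obtain ⟨v, rfl⟩ := hp m
      exact LinearMap.congr_fun hc v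
  have := isNoetherian_of_injective r hr
  infer_instance

/-- Over a local artinian ring, the dual detects projectivity. -/
theorem projective_of_projective_dual {A : Type u} [Ring A] [IsLocalRing A] [IsArtinianRing A]
    [IsNoetherian Aᵐᵒᵖ A] (M : Type u) [AddCommGroup M] [Module A M] [Module.Finite A M]
    [Module.Projective Aᵐᵒᵖ (Dl A M)] : Module.Projective A M := by
  have := finite_dual (A := A) M
  obtain ⟨n, x, f, hxf⟩ := exists_dual_basis (A := A) (Dl A M)
  obtain ⟨hfin, hproj⟩ := finite_projective_dual hxf
  have hsurj : Function.Surjective (evalL A M) := by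
    rw [← range_eq_top, ← Submodule.Quotient.subsingleton_iff]
    refine subsingleton_of_dual_eq_zero (A := A) _ fun φ => ?_
    obtain ⟨q, hq⟩ := evalR_surjective_of_dual_basis hxf (φ.comp (range (evalL A M)).mkQ)
    have hq0 : q = 0 := LinearMap.ext fun m => by
      have h1 := LinearMap.congr_fun hq (evalL A M m)
      have h2 : (range (evalL A M)).mkQ (evalL A M m) = 0 := by simp
      rw [LinearMap.comp_apply, h2, map_zero] at h1
      exact h1
    rw [hq0, map_zero] at hq
    exact Submodule.linearMap_qext _ (by rw [← hq]; rfl)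
  obtain ⟨s, hs⟩ := Module.projective_lifting_property (evalL A M) LinearMap.id hsurj
  have hs' : ∀ g, evalL A M (s g) = g := LinearMap.congr_fun hs
  let π : M →ₗ[A] ker (evalL A M) :=
    (LinearMap.id - s.comp (evalL A M)).codRestrict _ fun m => by simp [hs']
  have hπ : ∀ m : ker (evalL A M), π m = m := fun m => by
    ext
    simp [π, LinearMap.mem_ker.1 m.2]
  have : Module.Finite A (ker (evalL A M)) :=
    Module.Finite.of_surjective π fun m => ⟨m, hπ m⟩
  have hker : Subsingleton (ker (evalL A M)) := by
    refine subsingleton_of_dual_eq_zero (A := A) _ fun φ => LinearMap.ext fun m => ?_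
    have h := LinearMap.congr_fun (LinearMap.mem_ker.1 m.2) (φ.comp π)
    rw [← hπ m]
    exact h
  exact Module.Projective.of_equiv (LinearEquiv.ofBijective (evalL A M)
    ⟨LinearMap.ker_eq_bot.1 (Submodule.subsingleton_iff_eq_bot.1 hker), hsurj⟩).symm

/-- Proposition 4.1: over a local artin algebra, a semi-Gorenstein-projective module
with projective dual is projective. -/
theorem local_sgp_dual_projective_implies_projective (k : Type u) [CommRing k] [IsArtinianRing k]
    (A : Type u) [Ring A] [Algebra k A] [Module.Finite k A] [IsLocalRing A]
    (M : Type u) [AddCommGroup M] [Module A M] [Module.Finite A M]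
    (hsgp : sGp A M) (hproj : Module.Projective Aᵐᵒᵖ (Dl A M)) :
    Module.Projective A M := by
  have : IsArtinianRing A := IsArtinianRing.of_finite k A
  have : IsNoetherian Aᵐᵒᵖ A := isNoetherian_of_tower k inferInstance
  exact projective_of_projective_dual M
end
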